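/- arXiv:1704.04080 — 5 statements merged into one kernel-verified Lean document; each statement's English description precedes it below -/
import Mathlib

section
/- The separating variety V_sep is connected in codimension k if and only if X is connected in codimension k and G is generated by k-reflections on X. -/
noncomputable section

open TensorProduct PrimeSpectrum

section Defs

variable (K R G : Type*) [Field K] [CommRing R] [Algebra K R] [Group G]

/-- The subalgebra of `G`-invariant regular functions. -/
def invariantsAlg (φ : G →* (R ≃ₐ[K] R)) : Subalgebra K R where
  carrier := {f | ∀ σ : G, φ σ f = f}
  mul_mem' := fun {a b} ha hb σ => by rw [map_mul, ha σ, hb σ]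
  add_mem' := fun {a b} ha hb σ => by rw [map_add, ha σ, hb σ]
  algebraMap_mem' := fun r σ => (φ σ).commutes r

/-- δ(f) = f ⊗ 1 - 1 ⊗ f. -/
def deltaMap (f : R) : R ⊗[K] R := f ⊗ₜ[K] (1 : R) - (1 : R) ⊗ₜ[K] f

def sepIdeal (φ : G →* (R ≃ₐ[K] R)) : Ideal (R ⊗[K] R) :=
  Ideal.span (deltaMap K R '' (invariantsAlg K R G φ : Set R))

/-- The separating variety, as a closed subset of Spec (K[X] ⊗ K[X]). -/
def sepVariety (φ : G →* (R ≃ₐ[K] R)) : Set (PrimeSpectrum (R ⊗[K] R)) :=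
  zeroLocus (sepIdeal K R G φ : Set (R ⊗[K] R))

/-- The ideal I_σ generated by all σ·f - f. -/
def reflIdeal (φ : G →* (R ≃ₐ[K] R)) (σ : G) : Ideal R :=
  Ideal.span (Set.range fun f : R => φ σ f - f)

/-- Codimension of a subset `Z` inside a subset `S` of a prime spectrum:
the infimum of the heights (within `S`) of points of `Z`. -/
def codimIn {A : Type*} [CommRing A] (S Z : Set (PrimeSpectrum A)) : ℕ∞ :=
  ⨅ p : {q : S // (q : PrimeSpectrum A) ∈ Z}, Order.height (p : S)

/-- σ is a k-reflection: its fixed subvariety has codimension at most k. -/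
def IsKReflection (φ : G →* (R ≃ₐ[K] R)) (k : ℕ∞) (σ : G) : Prop :=
  codimIn (Set.univ) (zeroLocus (reflIdeal K R G φ σ : Set R)) ≤ k

/-- A subset `S` of a prime spectrum is connected in codimension `k`. -/
def ConnectedInCodim {A : Type*} [CommRing A] (S : Set (PrimeSpectrum A)) (k : ℕ∞) : Prop :=
  ∀ Z : Set (PrimeSpectrum A), (∃ C, IsClosed C ∧ Z = S ∩ C) → k < codimIn S Z →
    IsConnected (S \ Z)

/-- A separating set of invariants. -/
def IsSeparating (φ : G →* (R ≃ₐ[K] R)) (S : Set R) : Prop :=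
  S ⊆ (invariantsAlg K R G φ : Set R) ∧
  ∀ x y : R →ₐ[K] K, (∃ f ∈ invariantsAlg K R G φ, x f ≠ y f) → ∃ g ∈ S, x g ≠ y g

/-- The minimal size of a separating set of invariants. -/
def gammaSep (φ : G →* (R ≃ₐ[K] R)) : ℕ∞ :=
  ⨅ S ∈ {S : Set R | IsSeparating K R G φ S}, S.encard

/-- σ has a fixed (geometric) point. -/
def HasFixedPoint (φ : G →* (R ≃ₐ[K] R)) (σ : G) : Prop :=
  ∃ x : R →ₐ[K] K, ∀ f : R, x (φ σ f) = x f

/-- The component H_{σ,i} = {(x, σ x) : x ∈ X_i} of the separating variety,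
for a (minimal) prime p of K[X]. -/
def graphComp (φ : G →* (R ≃ₐ[K] R)) (σ : G) (p : Ideal R) :
    Set (PrimeSpectrum (R ⊗[K] R)) :=
  zeroLocus ((Ideal.comap
    (Algebra.TensorProduct.productMap (AlgHom.id K R) (φ σ⁻¹).toAlgHom) p : Ideal (R ⊗[K] R)) :
      Set (R ⊗[K] R))

/-- The depth of a Noetherian local ring: supremum of lengths of regular sequences
in the maximal ideal. -/
def localDepth (A : Type*) [CommRing A] [IsLocalRing A] : ℕ∞ :=
  sSup {n : ℕ∞ | ∃ rs : List A, (rs.length : ℕ∞) = n ∧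
    (∀ r ∈ rs, r ∈ IsLocalRing.maximalIdeal A) ∧ RingTheory.Sequence.IsRegular A rs}

/-- The Cohen-Macaulay defect of `A` is at most `k`. -/
def cmdefLE (A : Type*) [CommRing A] (k : ℕ∞) : Prop :=
  ∀ p : PrimeSpectrum A, ringKrullDim (Localization.AtPrime p.asIdeal) ≤
    ((localDepth (Localization.AtPrime p.asIdeal) + k : ℕ∞) : WithBot ℕ∞)

/-- The height of an ideal. -/
def idealHeight {A : Type*} [CommRing A] (I : Ideal A) : ℕ∞ :=
  ⨅ p : {q : PrimeSpectrum A // I ≤ q.asIdeal}, Order.height (p : PrimeSpectrum A)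



section Helpers

variable {K R G : Type*} [Field K] [CommRing R] [Algebra K R] [Group G]

def gMap (φ : G →* (R ≃ₐ[K] R)) (σ : G) : R ⊗[K] R →ₐ[K] R :=
  Algebra.TensorProduct.productMap (AlgHom.id K R) (φ σ).toAlgHom

lemma gMap_tmul (φ : G →* (R ≃ₐ[K] R)) (σ : G) (a b : R) :
    gMap φ σ (a ⊗ₜ[K] b) = a * φ σ b := by
  simp [gMap]

lemma gMap_surj (φ : G →* (R ≃ₐ[K] R)) (σ : G) : Function.Surjective (gMap φ σ) := fun a =>
  ⟨a ⊗ₜ 1, by simp [gMap_tmul]⟩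

def iMap (φ : G →* (R ≃ₐ[K] R)) (σ : G) : PrimeSpectrum R → PrimeSpectrum (R ⊗[K] R) :=
  PrimeSpectrum.comap (gMap φ σ).toRingHom

def pr1 : PrimeSpectrum (R ⊗[K] R) → PrimeSpectrum R :=
  PrimeSpectrum.comap (Algebra.TensorProduct.includeLeft (R := K) (S := K) (A := R) (B := R)).toRingHom

lemma mem_iMap (φ : G →* (R ≃ₐ[K] R)) (σ : G) (x : PrimeSpectrum R) (t : R ⊗[K] R) :
    t ∈ (iMap φ σ x).asIdeal ↔ gMap φ σ t ∈ x.asIdeal := Iff.rfl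

lemma mem_pr1 (p : PrimeSpectrum (R ⊗[K] R)) (a : R) :
    a ∈ (pr1 p : PrimeSpectrum R).asIdeal ↔ a ⊗ₜ[K] (1 : R) ∈ p.asIdeal := Iff.rfl

lemma pr1_iMap (φ : G →* (R ≃ₐ[K] R)) (σ : G) (x : PrimeSpectrum R) :
    pr1 (iMap φ σ x) = x := by
  ext a
  rw [mem_pr1, mem_iMap, gMap_tmul]
  simp

lemma continuous_iMap (φ : G →* (R ≃ₐ[K] R)) (σ : G) : Continuous (iMap φ σ) :=
  PrimeSpectrum.continuous_comap _

lemma continuous_pr1 : Continuous (pr1 : PrimeSpectrum (R ⊗[K] R) → PrimeSpectrum R) :=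
  PrimeSpectrum.continuous_comap _

lemma range_iMap (φ : G →* (R ≃ₐ[K] R)) (σ : G) :
    Set.range (iMap φ σ) = zeroLocus (RingHom.ker (gMap φ σ).toRingHom : Set (R ⊗[K] R)) :=
  _root_.range_comap_of_surjective _ _ (gMap_surj φ σ)

lemma isClosed_range (φ : G →* (R ≃ₐ[K] R)) (σ : G) : IsClosed (Set.range (iMap φ σ)) := by
  rw [range_iMap]; exact isClosed_zeroLocus _

lemma range_up (φ : G →* (R ≃ₐ[K] R)) (σ : G) {p q : PrimeSpectrum (R ⊗[K] R)}
    (h : p ∈ Set.range (iMap φ σ)) (hpq : p ≤ q) : q ∈ Set.range (iMap φ σ) := by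
  rw [range_iMap, mem_zeroLocus] at *
  exact h.trans hpq

lemma iMap_mono (φ : G →* (R ≃ₐ[K] R)) (σ : G) : StrictMono (iMap φ σ) := by
  apply Monotone.strictMono_of_injective
  · intro x y h t ht
    exact h ht
  · exact Function.LeftInverse.injective (pr1_iMap φ σ)

lemma iMap_eq_iff (φ : G →* (R ≃ₐ[K] R)) (σ τ : G) (x : PrimeSpectrum R) :
    iMap φ σ x = iMap φ τ x ↔ x ∈ zeroLocus (reflIdeal K R G φ (τ * σ⁻¹) : Set R) := by
  rw [mem_zeroLocus, SetLike.coe_subset_coe, reflIdeal, Ideal.span_le]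
  constructor
  · rintro h _ ⟨f, rfl⟩
    have h1 : (f ⊗ₜ[K] (1 : R) - (1 : R) ⊗ₜ[K] (φ σ⁻¹ f)) ∈ (iMap φ σ x).asIdeal := by
      rw [mem_iMap, map_sub, gMap_tmul, gMap_tmul, ← AlgEquiv.mul_apply, ← map_mul]
      simp
    rw [h, mem_iMap, map_sub, gMap_tmul, gMap_tmul, ← AlgEquiv.mul_apply, ← map_mul] at h1
    have := neg_mem h1
    simpa using this
  · intro h
    have key : ∀ t, gMap φ σ t - gMap φ τ t ∈ x.asIdeal := by
      intro t
      induction t with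
      | zero => simp
      | tmul a b =>
        rw [gMap_tmul, gMap_tmul, ← mul_sub]
        apply Ideal.mul_mem_left
        have h2 := h ⟨φ σ b, rfl⟩
        have h3 := neg_mem h2
        simp only [← AlgEquiv.mul_apply, ← map_mul] at h3
        simpa using h3
      | add a b ha hb =>
        rw [map_add, map_add, add_sub_add_comm]
        exact add_mem ha hb
    ext t
    change gMap φ σ t ∈ x.asIdeal ↔ gMap φ τ t ∈ x.asIdeal
    exact (Submodule.sub_mem_iff_left _ (key t) |>.symm.trans (by simp)).symm.symm

lemma iMap_mem (φ : G →* (R ≃ₐ[K] R)) (σ : G) (x : PrimeSpectrum R) :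
    iMap φ σ x ∈ sepVariety K R G φ := by
  rw [sepVariety, mem_zeroLocus, SetLike.coe_subset_coe, sepIdeal, Ideal.span_le]
  rintro _ ⟨f, hf, rfl⟩
  change _ ∈ (iMap φ σ x).asIdeal
  rw [mem_iMap, deltaMap, map_sub, gMap_tmul, gMap_tmul, hf σ]
  simp

lemma exists_iMap [Infinite K] [Finite G] (φ : G →* (R ≃ₐ[K] R)) {p : PrimeSpectrum (R ⊗[K] R)}
    (hp : p ∈ sepVariety K R G φ) : ∃ σ, p ∈ Set.range (iMap φ σ) := by
  classical
  have := Fintype.ofFinite G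
  rw [sepVariety, mem_zeroLocus, SetLike.coe_subset_coe, sepIdeal, Ideal.span_le] at hp
  let W : G → Subspace K R := fun σ =>
    { carrier := {f | φ σ f ⊗ₜ[K] (1 : R) - (1 : R) ⊗ₜ[K] f ∈ p.asIdeal}
      add_mem' := by
        intro a b ha hb
        have := p.asIdeal.add_mem ha hb
        simp only [Set.mem_ofPred_eq, map_add, TensorProduct.add_tmul, TensorProduct.tmul_add]
        convert this using 1
        ring
      zero_mem' := by simp
      smul_mem' := by
        intro c a ha
        simp only [Set.mem_ofPred_eq, map_smul, ← TensorProduct.smul_tmul', TensorProduct.tmul_smul,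
          ← smul_sub] at ha ⊢
        rw [Algebra.smul_def]
        exact Ideal.mul_mem_left _ _ ha }
  have hcov : ∀ f : R, ∃ σ, f ∈ W σ := by
    intro f
    let P : Polynomial R := ∏ σ : G, (Polynomial.X - Polynomial.C (φ σ f))
    have hinv : ∀ n, P.coeff n ∈ invariantsAlg K R G φ := by
      intro n τ
      have : P.map (φ τ : R →+* R) = P := by
        simp only [P, Polynomial.map_prod, Polynomial.map_sub, Polynomial.map_X, Polynomial.map_C]
        apply Fintype.prod_equiv (Equiv.mulLeft τ)
        intro σ
        simp
      conv_rhs => rw [← this]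
      rw [Polynomial.coeff_map]; rfl
    let il : R →+* R ⊗[K] R :=
      (Algebra.TensorProduct.includeLeft (R := K) (S := K) (A := R) (B := R)).toRingHom
    let ir : R →+* R ⊗[K] R :=
      (Algebra.TensorProduct.includeRight (R := K) (A := R) (B := R)).toRingHom
    have h0 : P.eval₂ ir (ir f) = 0 := by
      rw [Polynomial.eval₂_hom]
      have : P.eval f = 0 := by
        simp only [P, Polynomial.eval_prod]
        apply Finset.prod_eq_zero (Finset.mem_univ (1 : G))
        simp
      rw [this, map_zero]
    have h1 : P.eval₂ il (ir f) - P.eval₂ ir (ir f) ∈ p.asIdeal := by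
      rw [Polynomial.eval₂_eq_sum_range, Polynomial.eval₂_eq_sum_range, ← Finset.sum_sub_distrib]
      apply sum_mem
      intro n _
      rw [← sub_mul]
      apply Ideal.mul_mem_right
      exact hp ⟨_, hinv n, rfl⟩
    rw [h0, sub_zero] at h1
    have h2 : P.eval₂ il (ir f) = ∏ σ : G, (ir f - il (φ σ f)) := by
      simp [P, Polynomial.eval₂_finsetProd]
    rw [h2, Ideal.IsPrime.prod_mem_iff] at h1
    obtain ⟨σ, -, h⟩ := h1
    refine ⟨σ, ?_⟩
    have := neg_mem h
    rw [neg_sub] at this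
    exact this
  obtain ⟨σ, hσ⟩ : ∃ σ, W σ = ⊤ := by
    by_contra hne
    have := Subspace.biUnion_ne_univ_of_top_notMem (s := Finset.univ.image W) (by simpa using hne)
    apply this
    ext f
    simpa using hcov f
  refine ⟨σ, ?_⟩
  rw [range_iMap, mem_zeroLocus]
  have key : ∀ t, (gMap φ σ t) ⊗ₜ[K] (1 : R) - t ∈ p.asIdeal := by
    intro t
    induction t with
    | zero => simp
    | tmul a b =>
      have : b ∈ W σ := by rw [hσ]; trivial
      have := Ideal.mul_mem_left _ (a ⊗ₜ[K] (1 : R)) this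
      rw [mul_sub] at this
      simpa [gMap_tmul] using this
    | add a b ha hb =>
      rw [map_add, TensorProduct.add_tmul, add_sub_add_comm]
      exact add_mem ha hb
  intro t ht
  have ht' : gMap φ σ t = 0 := ht
  have := key t
  rw [ht', TensorProduct.zero_tmul, zero_sub] at this
  exact neg_mem_iff.1 this

lemma height_sep [Infinite K] [Finite G] (φ : G →* (R ≃ₐ[K] R)) (p : sepVariety K R G φ) :
    Order.height p = Order.height (pr1 (p : PrimeSpectrum (R ⊗[K] R))) := by
  apply le_antisymm
  · apply Order.height_le_height_apply_of_strictMono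
      (fun q : sepVariety K R G φ => pr1 (q : PrimeSpectrum (R ⊗[K] R)))
    intro a b hab
    have hab' : (a : PrimeSpectrum (R ⊗[K] R)) < b := hab
    obtain ⟨σ, hσ⟩ := exists_iMap φ a.2
    obtain ⟨y, hy⟩ := range_up φ σ hσ hab'.le
    obtain ⟨x, hx⟩ := hσ
    change pr1 a.1 < pr1 b.1
    rw [← hx, ← hy] at hab' ⊢
    rw [pr1_iMap, pr1_iMap]
    refine lt_of_le_of_ne ?_ (fun h => hab'.ne (by rw [h]))
    rw [← pr1_iMap φ σ x, ← pr1_iMap φ σ y]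
    intro t ht
    exact hab'.le ht
  · obtain ⟨σ, x, hx⟩ := exists_iMap φ p.2
    have : p = ⟨iMap φ σ x, iMap_mem φ σ x⟩ := Subtype.ext hx.symm
    rw [← hx, pr1_iMap, this]
    apply Order.height_le_height_apply_of_strictMono
      (fun x => (⟨iMap φ σ x, iMap_mem φ σ x⟩ : sepVariety K R G φ))
    exact iMap_mono φ σ

lemma lt_codimIn {A : Type*} [CommRing A] {S Z : Set (PrimeSpectrum A)} {k : ℕ∞} (hk : k ≠ ⊤) :
    k < codimIn S Z ↔ ∀ p : S, (p : PrimeSpectrum A) ∈ Z → k < Order.height p := by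
  simp only [← ENat.add_one_le_iff hk, codimIn, le_iInf_iff, Subtype.forall]

lemma lt_codimIn_univ {A : Type*} [CommRing A] {Z : Set (PrimeSpectrum A)} {k : ℕ∞} (hk : k ≠ ⊤) :
    k < codimIn Set.univ Z ↔ ∀ p ∈ Z, k < Order.height p := by
  rw [lt_codimIn hk]
  have : ∀ p : (Set.univ : Set (PrimeSpectrum A)), Order.height p = Order.height p.1 := fun p =>
    
    le_antisymm (Order.height_le_height_apply_of_strictMono
      (fun q : (Set.univ : Set (PrimeSpectrum A)) => q.1) (fun _ _ h => h) p)
      (Order.height_le_height_apply_of_strictMono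
      (fun q : PrimeSpectrum A => (⟨q, trivial⟩ : (Set.univ : Set (PrimeSpectrum A))))
      (fun _ _ h => h) p.1)
  simp only [this]
  simp

lemma lt_codimIn_sep [Infinite K] [Finite G] (φ : G →* (R ≃ₐ[K] R))
    {Z : Set (PrimeSpectrum (R ⊗[K] R))} {k : ℕ∞} (hk : k ≠ ⊤) :
    k < codimIn (sepVariety K R G φ) Z ↔ ∀ σ x, iMap φ σ x ∈ Z → k < Order.height x := by
  rw [lt_codimIn hk]
  simp only [height_sep]
  constructor
  · intro h σ x hx
    simpa [pr1_iMap] using h ⟨_, iMap_mem φ σ x⟩ hx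
  · rintro h ⟨p, hp⟩ hpZ
    obtain ⟨σ, x, rfl⟩ := exists_iMap φ hp
    simpa [pr1_iMap] using h σ x hpZ

end Helpers

section Statements

variable {K R G : Type*} [Field K] [IsAlgClosed K] [CommRing R] [IsReduced R] [Nontrivial R]
  [Algebra K R] [Group G] [Finite G]

/-- The separating variety is connected in codimension k iff X is
connected in codimension k and G is generated by k-reflections. -/
theorem sepVariety_connectedInCodim_iff (hfg : Algebra.FiniteType K R)
    (φ : G →* (R ≃ₐ[K] R)) (k : ℕ∞) :
    ConnectedInCodim (sepVariety K R G φ) k ↔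
      (ConnectedInCodim (Set.univ : Set (PrimeSpectrum R)) k ∧
        Subgroup.closure {σ : G | IsKReflection K R G φ k σ} = ⊤) := by
  have : Infinite K := IsAlgClosed.instInfinite
  by_cases hk : k = ⊤
  · subst hk
    simp [ConnectedInCodim, IsKReflection]
  have hrefl : ∀ σ, IsKReflection K R G φ k σ ↔
      ∃ x ∈ zeroLocus (reflIdeal K R G φ σ : Set R), Order.height x ≤ k := by
    intro σ
    rw [IsKReflection, ← not_lt, lt_codimIn_univ hk]
    push Not
    rfl
  constructor
  · intro h
    constructor
    · rintro _ ⟨C, hC, rfl⟩ hlt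
      rw [lt_codimIn_univ hk] at hlt
      have h1 := h (sepVariety K R G φ ∩ pr1 ⁻¹' C) ⟨_, hC.preimage continuous_pr1, rfl⟩ (by
        rw [lt_codimIn_sep φ hk]
        intro σ x hx
        apply hlt
        have := hx.2
        rw [Set.mem_preimage, pr1_iMap] at this
        exact ⟨trivial, this⟩)
      have h2 := h1.image pr1 continuous_pr1.continuousOn
      convert h2 using 1
      ext x
      constructor
      · intro hx
        refine ⟨iMap φ 1 x, ⟨iMap_mem _ _ _, ?_⟩, pr1_iMap _ _ _⟩
        intro hx'
        have := hx'.2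
        rw [Set.mem_preimage, pr1_iMap] at this
        exact hx.2 ⟨trivial, this⟩
      · rintro ⟨p, ⟨hp, hp'⟩, rfl⟩
        exact ⟨trivial, fun hx => hp' ⟨hp, hx.2⟩⟩
    · set H := Subgroup.closure {σ : G | IsKReflection K R G φ k σ} with hH
      rw [eq_top_iff]
      intro τ _
      by_contra hτ
      let A := ⋃ σ ∈ {σ : G | σ ∈ H}, Set.range (iMap φ σ)
      let B := ⋃ σ ∈ {σ : G | σ ∉ H}, Set.range (iMap φ σ)
      have hA : IsClosed A := (Set.toFinite _).isClosed_biUnion fun σ _ => isClosed_range φ σ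
      have hB : IsClosed B := (Set.toFinite _).isClosed_biUnion fun σ _ => isClosed_range φ σ
      have hAB : ∀ σ x, iMap φ σ x ∈ A ∩ B → k < Order.height x := by
        rintro σ x ⟨h1, h2⟩
        simp only [A, B, Set.mem_iUnion] at h1 h2
        obtain ⟨a, ha, y, hy⟩ := h1
        obtain ⟨b, hb, z, hz⟩ := h2
        have hy' := congrArg pr1 hy
        have hz' := congrArg pr1 hz
        rw [pr1_iMap, pr1_iMap] at hy' hz'
        subst hy' hz'
        by_contra hlt
        have hr : b * a⁻¹ ∈ H := Subgroup.subset_closure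
          ((hrefl _).2 ⟨_, (iMap_eq_iff φ a b _).1 (hy.trans hz.symm), not_lt.1 hlt⟩)
        apply hb
        simpa using H.mul_mem hr ha
      have hconn := h (sepVariety K R G φ ∩ (A ∩ B)) ⟨_, hA.inter hB, rfl⟩ (by
        rw [lt_codimIn_sep φ hk]
        exact fun σ x hx => hAB σ x hx.2)
      obtain ⟨x, hx⟩ : ∃ x : PrimeSpectrum R, Order.height x = 0 := by
        obtain ⟨m, hm⟩ := Ideal.nonempty_minimalPrimes (I := (⊥ : Ideal R)) bot_ne_top
        refine ⟨⟨m, hm.1.1⟩, ?_⟩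
        rw [Order.height_eq_zero]
        intro q hq
        exact hm.2 ⟨q.2, bot_le⟩ hq
      have hS : ∀ σ, iMap φ σ x ∈ sepVariety K R G φ \ (sepVariety K R G φ ∩ (A ∩ B)) := by
        intro σ
        refine ⟨iMap_mem _ _ _, fun hx' => ?_⟩
        have := hAB σ x hx'.2
        rw [hx] at this
        exact not_lt_zero this
      obtain ⟨p, hp, hp'⟩ := isPreconnected_closed_iff.1 hconn.isPreconnected A B hA hB (by
          rintro p ⟨hp, -⟩
          obtain ⟨σ, hσ⟩ := exists_iMap φ hp
          by_cases hs : σ ∈ H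
          · exact Or.inl (Set.mem_biUnion (show σ ∈ {σ : G | σ ∈ H} from hs) hσ)
          · exact Or.inr (Set.mem_biUnion (show σ ∈ {σ : G | σ ∉ H} from hs) hσ))
        ⟨_, hS 1, Set.mem_biUnion (show (1 : G) ∈ {σ : G | σ ∈ H} from H.one_mem) ⟨x, rfl⟩⟩
        ⟨_, hS τ, Set.mem_biUnion (show τ ∈ {σ : G | σ ∉ H} from hτ) ⟨x, rfl⟩⟩
      exact hp.2 ⟨hp.1, hp'⟩
  · rintro ⟨hX, hG⟩ _ ⟨C, hC, rfl⟩ hlt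
    rw [lt_codimIn_sep φ hk] at hlt
    let s : G → Set (PrimeSpectrum (R ⊗[K] R)) := fun σ => iMap φ σ '' (Set.univ \ (Set.univ ∩ iMap φ σ ⁻¹' C))
    have hs : ∀ σ, IsConnected (s σ) := by
      intro σ
      apply IsConnected.image _ _ (continuous_iMap φ σ).continuousOn
      apply hX _ ⟨_, hC.preimage (continuous_iMap φ σ), rfl⟩
      rw [lt_codimIn_univ hk]
      intro x hx
      exact hlt σ x ⟨iMap_mem _ _ _, hx.2⟩
    have heq : sepVariety K R G φ \ (sepVariety K R G φ ∩ C) = ⋃ σ, s σ := by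
      ext p
      simp only [Set.mem_iUnion]
      constructor
      · rintro ⟨hp, hp'⟩
        obtain ⟨σ, x, rfl⟩ := exists_iMap φ hp
        exact ⟨σ, x, ⟨trivial, fun hx => hp' ⟨hp, hx.2⟩⟩, rfl⟩
      · rintro ⟨σ, x, hx, rfl⟩
        exact ⟨iMap_mem _ _ _, fun h => hx.2 ⟨trivial, h.2⟩⟩
    rw [heq]
    let r : G → G → Prop := fun i j => (s i ∩ s j).Nonempty
    have hsymm : ∀ {a b}, Relation.ReflTransGen r a b → Relation.ReflTransGen r b a := by
      intro a b hab
      induction hab with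
      | refl => exact .refl
      | tail _ h ih => exact Relation.ReflTransGen.head (by obtain ⟨x, h1, h2⟩ := h; exact ⟨x, h2, h1⟩) ih
    have hchain : ∀ ρ : G, ∀ σ, Relation.ReflTransGen r σ (ρ * σ) := by
      intro ρ
      have hρ : ρ ∈ Subgroup.closure {σ : G | IsKReflection K R G φ k σ} := by rw [hG]; trivial
      induction hρ using Subgroup.closure_induction with
      | mem ρ hρ =>
        intro σ
        apply Relation.ReflTransGen.single
        obtain ⟨x, hx, hxk⟩ := (hrefl ρ).1 hρ
        have e : iMap φ σ x = iMap φ (ρ * σ) x := by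
          rw [iMap_eq_iff]; simpa using hx
        have hn : ∀ τ, iMap φ τ x ∈ s τ := fun τ =>
          ⟨x, ⟨trivial, fun h => not_lt.2 hxk (hlt τ x ⟨iMap_mem _ _ _, h.2⟩)⟩, rfl⟩
        exact ⟨iMap φ σ x, hn σ, e ▸ hn (ρ * σ)⟩
      | one => intro σ; rw [one_mul]
      | mul a b _ _ ha hb =>
        intro σ
        rw [mul_assoc]
        exact (hb σ).trans (ha _)
      | inv a _ ha =>
        intro σ
        have := ha (a⁻¹ * σ)
        rw [mul_inv_cancel_left] at this
        exact hsymm this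
    refine ⟨?_, IsPreconnected.iUnion_of_reflTransGen (fun σ => (hs σ).isPreconnected) ?_⟩
    · obtain ⟨p, hp⟩ := (hs 1).nonempty
      exact ⟨p, Set.mem_iUnion.2 ⟨1, hp⟩⟩
    · intro i j
      have := hchain (j * i⁻¹) i
      rwa [inv_mul_cancel_right] at this

end Statements
end Defs
end
end

section
/- Let R be a Noetherian ring with connected spectrum and finite Cohen-Macaulay defect k = cmdef(R) = sup over primes p of (dim R_p - depth R_p). Then Spec(R) is connected in codimension k + 1. -/
noncomputable section

open TensorProduct PrimeSpectrum

section Defs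

variable (K R G : Type*) [Field K] [CommRing R] [Algebra K R] [Group G]

lemma hc_reg_pow {S : Type*} [CommRing S] {a b : S} (ha : ∀ x y : S, a * x = a * y → x = y)
    (hb : ∀ x : S, a ∣ b * x → a ∣ x) (m n : ℕ) : ∀ x : S, a ^ n ∣ b ^ m * x → a ^ n ∣ x := by
  have hb' : ∀ (m : ℕ) (x : S), a ∣ b ^ m * x → a ∣ x := by
    intro m
    induction m with
    | zero => intro x hx; simpa using hx
    | succ m ih =>
      intro x hx
      apply ih
      apply hb
      rwa [← mul_assoc, ← pow_succ']
  induction n with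
  | zero => intro x _; simp
  | succ n ih =>
    intro x hx
    obtain ⟨x', rfl⟩ : a ∣ x := hb' m x ((Dvd.intro_left _ rfl : a ∣ a ^ n * a).trans
      (by rwa [← pow_succ]))
    obtain ⟨y, hy⟩ := hx
    have h1 : b ^ m * x' = a ^ n * y := ha _ _ (by rw [pow_succ'] at hy; linear_combination hy)
    obtain ⟨z, rfl⟩ := ih x' ⟨y, h1⟩
    exact ⟨z, by ring⟩

lemma hc_local {S : Type*} [CommRing S] [IsLocalRing S] {a b : S}
    (ha : ∀ x y : S, a * x = a * y → x = y)
    (hb : ∀ x : S, a ∣ b * x → a ∣ x) (I J : Ideal S) (hIJ : I * J = ⊥)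
    (har : a ∈ (I ⊔ J).radical) (hbr : b ∈ (I ⊔ J).radical) : I = ⊥ ∨ J = ⊥ := by
  obtain ⟨n, hn⟩ := har
  obtain ⟨m, hm⟩ := hbr
  obtain ⟨i, hi, j, hj, hij⟩ := Submodule.mem_sup.1 hn
  obtain ⟨i', hi', j', hj', hij'⟩ := Submodule.mem_sup.1 hm
  have hz : ∀ x ∈ I, ∀ y ∈ J, x * y = 0 := fun x hx y hy => by
    have := Ideal.mul_mem_mul hx hy
    rw [hIJ] at this
    simpa using this
  have han : ∀ (n : ℕ) (x y : S), a ^ n * x = a ^ n * y → x = y := by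
    intro n
    induction n with
    | zero => intro x y h; simpa using h
    | succ n ih =>
      intro x y h
      apply ih
      apply ha
      rw [pow_succ'] at h
      linear_combination h
  obtain ⟨e, he⟩ : a ^ n ∣ i := hc_reg_pow ha hb m n i
    ⟨i', by linear_combination (-i) * hij' + i' * hij + hz i hi j' hj' - hz i' hi' j hj⟩
  have hee : e * (1 - e) = 0 := by
    apply han n
    apply han n
    have h1 : i * i = i * a ^ n := by linear_combination i * hij - hz i hi j hj
    rw [he] at h1
    linear_combination -h1
  rcases IsLocalRing.isUnit_or_isUnit_of_add_one (a := e) (b := 1 - e) (by ring) with h | h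
  · right
    have h2 : 1 - e = 0 := h.mul_right_eq_zero.1 hee
    have h3 : i = a ^ n := by rw [he]; linear_combination (-a ^ n) * h2
    rw [eq_bot_iff]
    intro y hy
    have := hz i hi y hy
    rw [h3] at this
    simpa using han n y 0 (by simpa using this)
  · left
    have h2 : e = 0 := h.mul_left_eq_zero.1 hee
    have h3 : j = a ^ n := by rw [← hij, he, h2]; ring
    rw [eq_bot_iff]
    intro y hy
    have := hz y hy j hj
    rw [h3] at this
    simpa using han n y 0 (by rw [mul_comm]; simpa using this)

lemma hc_depth {S : Type*} [CommRing S] [IsLocalRing S] (h : 2 ≤ localDepth S) :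
    ∃ a ∈ IsLocalRing.maximalIdeal S, ∃ b ∈ IsLocalRing.maximalIdeal S,
      (∀ x y : S, a * x = a * y → x = y) ∧ (∀ x : S, a ∣ b * x → a ∣ x) := by
  have h1 : (1 : ℕ∞) < localDepth S := lt_of_lt_of_le (by norm_num) h
  obtain ⟨_, ⟨rs, rfl, hm, hr⟩, hl⟩ := lt_sSup_iff.1 h1
  match rs, hm, hr, hl with
  | [], _, _, hl => simp at hl
  | [_], _, _, hl => simp at hl
  | a :: b :: rs, hm, hr, _ =>
    rw [RingTheory.Sequence.isRegular_cons_iff, RingTheory.Sequence.isRegular_cons_iff] at hr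
    obtain ⟨h1, h2, _⟩ := hr
    refine ⟨a, hm a (by simp), b, hm b (by simp), fun x y hxy => h1 hxy, fun x hx => ?_⟩
    have := (isSMulRegular_quotient_iff_mem_of_smul_mem _ _).1 h2 x
    simp only [Submodule.mem_smul_pointwise_iff_exists, Submodule.mem_top, true_and,
      smul_eq_mul] at this
    obtain ⟨c, hc⟩ := hx
    obtain ⟨d, hd⟩ := this ⟨c, hc.symm⟩
    exact ⟨d, hd.symm⟩

lemma hc_key {A : Type*} [CommRing A] [IsNoetherianRing A] (p : PrimeSpectrum A)
    (hd : 2 ≤ localDepth (Localization.AtPrime p.asIdeal)) (I J : Ideal A)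
    (hIJ : I * J ≤ nilradical A) (hp : p.asIdeal ∈ (I ⊔ J).minimalPrimes) :
    (∀ q : PrimeSpectrum A, q ≤ p → I ≤ q.asIdeal) ∨
    (∀ q : PrimeSpectrum A, q ≤ p → J ≤ q.asIdeal) := by
  obtain ⟨a, ham, b, hbm, ha, hb⟩ := hc_depth hd
  obtain ⟨n, hn⟩ := IsNoetherianRing.isNilpotent_nilradical A
  have hn' : I ^ n * J ^ n = ⊥ := by
    rw [← mul_pow, eq_bot_iff]
    exact (Ideal.pow_right_mono hIJ n).trans hn.le
  let S := Localization.AtPrime p.asIdeal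
  let f := algebraMap A S
  have hrad : ∀ r ∈ IsLocalRing.maximalIdeal S,
      r ∈ ((I ^ n).map f ⊔ (J ^ n).map f).radical := by
    intro r hr
    rw [Ideal.radical_eq_sInf, Ideal.mem_sInf]
    rintro Q ⟨hQ, hQp⟩
    have hc : I ⊔ J ≤ Q.comap f := by
      have hpr : (Q.comap f).IsPrime := inferInstance
      rw [sup_le_iff] at hQ ⊢
      exact ⟨hpr.le_of_pow_le (Ideal.map_le_iff_le_comap.1 hQ.1),
        hpr.le_of_pow_le (Ideal.map_le_iff_le_comap.1 hQ.2)⟩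
    have hle : Q.comap f ≤ p.asIdeal := by
      refine le_of_le_of_eq ?_ (IsLocalization.AtPrime.under_maximalIdeal S p.asIdeal)
      exact Ideal.comap_mono (IsLocalRing.le_maximalIdeal hQp.ne_top)
    have hge := hp.2 ⟨inferInstance, hc⟩ hle
    rw [← IsLocalization.map_under p.asIdeal.primeCompl S (IsLocalRing.maximalIdeal S)] at hr
    rw [IsLocalization.AtPrime.under_maximalIdeal S p.asIdeal] at hr
    exact Ideal.map_le_iff_le_comap.2 hge hr
  have hfin : ∀ K : Ideal A, (K ^ n).map f = ⊥ → ∀ q : PrimeSpectrum A, q ≤ p → K ≤ q.asIdeal := by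
    intro K hK q hq
    apply q.isPrime.le_of_pow_le (n := n)
    intro x hx
    have h0 : f x = 0 := by
      have := Ideal.mem_map_of_mem f hx
      rw [hK] at this
      simpa using this
    obtain ⟨s, hs⟩ := (IsLocalization.map_eq_zero_iff p.asIdeal.primeCompl S x).1 h0
    have : (s : A) * x ∈ q.asIdeal := by rw [hs]; exact zero_mem _
    exact (q.isPrime.mem_or_mem this).resolve_left fun h => s.2 (hq h)
  rcases hc_local ha hb _ _ (by rw [← Ideal.map_mul, hn', Ideal.map_bot])
    (hrad a ham) (hrad b hbm) with h | h
  · exact Or.inl (hfin I h)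
  · exact Or.inr (hfin J h)

section Statements

/-- Hartshorne's connectedness theorem, CM-defect form.
If R is Noetherian, Spec(R) is connected, and the Cohen-Macaulay defect of R is at
most a finite k, then Spec(R) is connected in codimension k + 1. -/
theorem hartshorne_connectedness (R : Type*) [CommRing R] [IsNoetherianRing R]
    (hconn : IsConnected (Set.univ : Set (PrimeSpectrum R)))
    (k : ℕ) (hk : cmdefLE R (k : ℕ∞)) :
    ConnectedInCodim (Set.univ : Set (PrimeSpectrum R)) ((k : ℕ∞) + 1) := by
  rintro Z ⟨C, hC, rfl⟩ hcod
  have hht : ∀ p ∈ C, ((k : ℕ∞) + 1) < Order.height p := by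
    intro p hp
    refine hcod.trans_le ((iInf_le _ ⟨⟨p, trivial⟩, ⟨trivial, hp⟩⟩).trans ?_)
    exact (Order.height_orderIso (OrderIso.Set.univ (α := PrimeSpectrum R)) ⟨p, trivial⟩).ge
  have hdepth : ∀ p ∈ C, 2 ≤ localDepth (Localization.AtPrime p.asIdeal) := by
    intro p hp
    have h1 := hk p
    rw [IsLocalization.AtPrime.ringKrullDim_eq_height p.asIdeal, WithBot.coe_le_coe,
      PrimeSpectrum.height_eq_orderHeight] at h1
    have h2 := (hht p hp).trans_le h1
    cases hl : localDepth (Localization.AtPrime p.asIdeal) with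
    | top => exact le_top
    | coe d =>
      rw [hl] at h2
      have h3 : k + 1 < d + k := by exact_mod_cast h2
      have : 2 ≤ d := by omega
      exact_mod_cast this
  have hminC : ∀ p : PrimeSpectrum R, p.asIdeal ∈ minimalPrimes R → p ∉ C := by
    intro p hp hpC
    have h1 := hht p hpC
    rw [← PrimeSpectrum.height_eq_orderHeight, Ideal.height_eq_zero_iff.2 hp] at h1
    simp at h1
  have hexmin : ∀ p : PrimeSpectrum R, ∃ q : PrimeSpectrum R, q.asIdeal ∈ minimalPrimes R ∧ q ≤ p := by
    intro p
    obtain ⟨q, hq, hqp⟩ := Ideal.exists_minimalPrimes_le (bot_le : (⊥ : Ideal R) ≤ p.asIdeal)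
    exact ⟨⟨q, hq.1.1⟩, hq, hqp⟩
  have hup : ∀ t : Set (PrimeSpectrum R), IsClosed t → ∀ q p : PrimeSpectrum R, q ≤ p → q ∈ t → p ∈ t := by
    intro t ht q p hqp hq
    exact ((PrimeSpectrum.le_iff_specializes q p).1 hqp).mem_closed ht hq
  rw [Set.univ_inter]
  refine ⟨?_, ?_⟩
  · obtain ⟨x, -⟩ := hconn.nonempty
    obtain ⟨q, hq, -⟩ := hexmin x
    exact ⟨q, trivial, hminC q hq⟩
  rw [isPreconnected_closed_iff]
  intro t t' ht ht' hcov hne hne'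
  by_contra hcon
  have hdisj : ∀ p, p ∈ t → p ∈ t' → p ∈ C := by
    intro p h1 h2
    by_contra h3
    exact hcon ⟨p, ⟨trivial, h3⟩, h1, h2⟩
  have hmk : ∀ t : Set (PrimeSpectrum R), ∃ I : Ideal R, ∀ p : PrimeSpectrum R,
      I ≤ p.asIdeal ↔ ∃ q : PrimeSpectrum R, q.asIdeal ∈ minimalPrimes R ∧ q ∈ t ∧ q ≤ p := by
    intro t
    have hf : {q : PrimeSpectrum R | q.asIdeal ∈ minimalPrimes R ∧ q ∈ t}.Finite := by
      refine Set.Finite.subset ((minimalPrimes.finite_of_isNoetherianRing R).preimage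
        (f := PrimeSpectrum.asIdeal) ?_) (fun q hq => hq.1)
      intro x _ y _ h
      exact PrimeSpectrum.ext h
    refine ⟨hf.toFinset.inf PrimeSpectrum.asIdeal, fun p => ?_⟩
    rw [p.isPrime.inf_le']
    simp only [Set.Finite.mem_toFinset, Set.mem_ofPred_eq, and_assoc]
    rfl
  obtain ⟨I, hI⟩ := hmk t
  obtain ⟨J, hJ⟩ := hmk t'
  have hall : ∀ p : PrimeSpectrum R, I ≤ p.asIdeal ∨ J ≤ p.asIdeal := by
    intro p
    obtain ⟨q, hq, hqp⟩ := hexmin p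
    rcases hcov ⟨trivial, hminC q hq⟩ with h | h
    · exact Or.inl ((hI p).2 ⟨q, hq, h, hqp⟩)
    · exact Or.inr ((hJ p).2 ⟨q, hq, h, hqp⟩)
  have hIne : ∃ p : PrimeSpectrum R, I ≤ p.asIdeal := by
    obtain ⟨x, ⟨-, hx⟩, hxt⟩ := hne
    refine ⟨x, (hall x).resolve_right fun h => ?_⟩
    obtain ⟨q, _, hqt, hqx⟩ := (hJ x).1 h
    exact hx (hdisj x hxt (hup t' ht' q x hqx hqt))
  have hJne : ∃ p : PrimeSpectrum R, J ≤ p.asIdeal := by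
    obtain ⟨x, ⟨-, hx⟩, hxt⟩ := hne'
    refine ⟨x, (hall x).resolve_left fun h => ?_⟩
    obtain ⟨q, _, hqt, hqx⟩ := (hI x).1 h
    exact hx (hdisj x (hup t ht q x hqx hqt) hxt)
  obtain ⟨x, -, hxI, hxJ⟩ := isPreconnected_closed_iff.1 hconn.isPreconnected
    (zeroLocus (I : Set R)) (zeroLocus (J : Set R)) (isClosed_zeroLocus _) (isClosed_zeroLocus _)
    (fun p _ => hall p) (by obtain ⟨p, hp⟩ := hIne; exact ⟨p, trivial, hp⟩)
    (by obtain ⟨p, hp⟩ := hJne; exact ⟨p, trivial, hp⟩)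
  have hx : I ⊔ J ≤ x.asIdeal := sup_le hxI hxJ
  obtain ⟨P, hP, -⟩ := Ideal.exists_minimalPrimes_le hx
  let p : PrimeSpectrum R := ⟨P, hP.1.1⟩
  have hpIJ : I ⊔ J ≤ p.asIdeal := hP.1.2
  obtain ⟨q, hqm, hqt, hqp⟩ := (hI p).1 (le_sup_left.trans hpIJ)
  obtain ⟨q', hqm', hqt', hqp'⟩ := (hJ p).1 (le_sup_right.trans hpIJ)
  have hpC : p ∈ C := hdisj p (hup t ht q p hqp hqt) (hup t' ht' q' p hqp' hqt')
  have hnil : I * J ≤ nilradical R := by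
    rw [nilradical, Ideal.radical_eq_sInf]
    refine le_sInf fun Q hQ => ?_
    rcases hall ⟨Q, hQ.2⟩ with h | h
    · exact Ideal.mul_le_left.trans h
    · exact Ideal.mul_le_right.trans h
  have hmineq : ∀ r s : PrimeSpectrum R, s.asIdeal ∈ minimalPrimes R → r ≤ s → r = s := by
    intro r s hs hrs
    exact le_antisymm hrs (hs.2 ⟨r.isPrime, bot_le⟩ hrs)
  rcases hc_key p (hdepth p hpC) I J hnil hP with h | h
  · obtain ⟨r, hr, hrt, hrq⟩ := (hI q').1 (h q' hqp')
    have := hmineq r q' hqm' hrq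
    subst this
    exact hminC r hr (hdisj r hrt hqt')
  · obtain ⟨r, hr, hrt, hrq⟩ := (hJ q).1 (h q hqp)
    have := hmineq r q hqm hrq
    subst this
    exact hminC r hr (hdisj r hqt hrt)

end Statements
end Defs
end
end

section
/- Assume the affine G-variety X is connected, G is generated by elements having a fixed point, R = K[X] ⊗_K K[X], and k is the minimum of cmdef(R/J) over all ideals J ⊆ R with √J = √I_sep. Then G is generated by (k+1)-reflections on X. -/
noncomputable section

open TensorProduct PrimeSpectrum

section Defs

variable (K R G : Type*) [Field K] [CommRing R] [Algebra K R] [Group G]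

section Helpers

theorem aux_reg_pow_right {B : Type*} [CommRing B] {a b : B}
    (hb : ∀ x, a ∣ b * x → a ∣ x) (n : ℕ) : ∀ x, a ∣ b ^ n * x → a ∣ x := by
  induction n with
  | zero => intro x hx; simpa using hx
  | succ n ih =>
    intro x hx
    rw [pow_succ, mul_assoc] at hx
    exact hb x (ih _ hx)

theorem aux_reg_pow_left {B : Type*} [CommRing B] {a b : B}
    (ha : ∀ x, a * x = 0 → x = 0)
    (hb : ∀ x, a ∣ b * x → a ∣ x) (n : ℕ) : ∀ x, a ^ n ∣ b * x → a ^ n ∣ x := by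
  induction n with
  | zero => intro x _; simp
  | succ n ih =>
    intro x hx
    obtain ⟨y, hy⟩ := hx
    obtain ⟨x', rfl⟩ := hb x ⟨a ^ n * y, by rw [hy]; ring⟩
    have h2 : b * x' = a ^ n * y := by
      have := ha (b * x' - a ^ n * y) (by linear_combination hy)
      exact sub_eq_zero.mp this
    obtain ⟨z, rfl⟩ := ih x' ⟨y, h2⟩
    exact ⟨z, by ring⟩

theorem aux_local {B : Type*} [CommRing B] [IsLocalRing B] [IsNoetherianRing B] {a b : B}
    (ham : a ∈ IsLocalRing.maximalIdeal B) (hbm : b ∈ IsLocalRing.maximalIdeal B)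
    (ha : ∀ x, a * x = 0 → x = 0)
    (hb : ∀ x, a ∣ b * x → a ∣ x) (J1 J2 : Ideal B)
    (h12 : ∀ Q : Ideal B, Q.IsPrime → J1 ≤ Q ∨ J2 ≤ Q)
    (hm : ∀ Q : Ideal B, Q.IsPrime → J1 ≤ Q → J2 ≤ Q → Q = IsLocalRing.maximalIdeal B) :
    (∀ Q : Ideal B, Q.IsPrime → J1 ≤ Q → Q = IsLocalRing.maximalIdeal B) ∨
    (∀ Q : Ideal B, Q.IsPrime → J2 ≤ Q → Q = IsLocalRing.maximalIdeal B) := by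
  have hnil : J1 * J2 ≤ (⊥ : Ideal B).radical := by
    rw [Ideal.radical_eq_sInf]
    refine le_sInf ?_
    rintro Q ⟨-, hQ⟩
    rcases h12 Q hQ with h | h
    · exact Ideal.mul_le_left.trans h
    · exact Ideal.mul_le_right.trans h
  obtain ⟨N, hN⟩ := Ideal.exists_radical_pow_le_of_fg (⊥ : Ideal B) (IsNoetherian.noetherian _)
  have hN' : J1 ^ N * J2 ^ N = ⊥ := by
    rw [← mul_pow, eq_bot_iff]
    exact (Ideal.pow_right_mono hnil N).trans hN
  have hmul : ∀ u ∈ J1 ^ N, ∀ v ∈ J2 ^ N, u * v = 0 := by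
    intro u hu v hv
    have := Ideal.mul_mem_mul hu hv
    rw [hN'] at this
    simpa using this
  have hrad : IsLocalRing.maximalIdeal B ≤ (J1 ^ N ⊔ J2 ^ N).radical := by
    rw [Ideal.radical_eq_sInf]
    refine le_sInf ?_
    rintro Q ⟨hQ1, hQ⟩
    have e1 : J1 ≤ Q := hQ.le_of_pow_le (le_sup_left.trans hQ1)
    have e2 : J2 ≤ Q := hQ.le_of_pow_le (le_sup_right.trans hQ1)
    rw [hm Q hQ e1 e2]
  obtain ⟨n, hn⟩ := hrad ham
  obtain ⟨m, hm'⟩ := hrad hbm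
  obtain ⟨u, hu, v, hv, huv⟩ := Submodule.mem_sup.mp hn
  obtain ⟨s, hs, t, ht, hst⟩ := Submodule.mem_sup.mp hm'
  have han : ∀ x, a ^ n * x = 0 → x = 0 := by
    clear hn huv
    induction n with
    | zero => intro x hx; simpa using hx
    | succ n ih =>
      intro x hx
      rw [pow_succ, mul_assoc] at hx
      exact ha x (ih _ hx)
  have hbn : ∀ x, a ^ n ∣ b ^ m * x → a ^ n ∣ x :=
    aux_reg_pow_right (aux_reg_pow_left ha hb n) m
  have key : a ^ n ∣ u := by
    apply hbn
    refine ⟨s, ?_⟩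
    rw [← hst, ← huv]
    have e1 := hmul u hu t ht
    have e2 := hmul s hs v hv
    linear_combination e1 - e2
  obtain ⟨c, hc⟩ := key
  have hv' : v = a ^ n * (1 - c) := by linear_combination huv - hc
  have hcc : c * (1 - c) = 0 := by
    apply han; apply han
    have := hmul u hu v hv
    rw [hc, hv'] at this
    linear_combination this
  have fin1 : ∀ I1 I2 : Ideal B, (∀ u ∈ I1 ^ N, ∀ v ∈ I2 ^ N, u * v = 0) →
      a ^ n ∈ I2 ^ N → ∀ Q : Ideal B, Q.IsPrime → I1 ≤ Q := by
    intro I1 I2 h hmem Q hQ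
    refine hQ.le_of_pow_le (n := N) ?_
    intro x hx
    have : x = 0 := han x (by rw [mul_comm]; exact h x hx _ hmem)
    rw [this]; exact Q.zero_mem
  rcases IsLocalRing.isUnit_or_isUnit_one_sub_self c with hu' | hu'
  · have : 1 - c = 0 := by simpa using (hu'.mul_right_eq_zero).mp hcc
    left
    intro Q hQ h1
    refine hm Q hQ h1 (fin1 J2 J1 (fun u hu v hv => by rw [mul_comm]; exact hmul v hv u hu) ?_ Q hQ)
    rw [← huv, hv', this]; simpa using hu
  · have : c = 0 := (hu'.mul_left_eq_zero).mp hcc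
    right
    intro Q hQ h2
    refine hm Q hQ (fin1 J1 J2 hmul ?_ Q hQ) h2
    rw [← huv, hc, this]; simpa using hv

theorem aux_depth {B : Type*} [CommRing B] [IsLocalRing B] (h : 2 ≤ localDepth B) :
    ∃ a b : B, a ∈ IsLocalRing.maximalIdeal B ∧ b ∈ IsLocalRing.maximalIdeal B ∧
      (∀ x, a * x = 0 → x = 0) ∧ (∀ x, a ∣ b * x → a ∣ x) := by
  have h1 : (1 : ℕ∞) < localDepth B := lt_of_lt_of_le (by norm_num) h
  obtain ⟨_, ⟨rs, rfl, hmem, hreg⟩, hlt⟩ := lt_sSup_iff.mp h1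
  match rs, hmem, hreg, hlt with
  | [], _, _, hlt => simp at hlt
  | [_], _, _, hlt => simp at hlt
  | a :: b :: rs, hmem, hreg, _ =>
    rw [RingTheory.Sequence.isRegular_cons_iff, RingTheory.Sequence.isRegular_cons_iff] at hreg
    obtain ⟨ha, hb, -⟩ := hreg
    refine ⟨a, b, hmem a (by simp), hmem b (by simp), ?_, ?_⟩
    · intro x hx
      exact ha (by simpa using hx)
    · intro x ⟨y, hy⟩
      have hmk : ∀ z : B, (Submodule.Quotient.mk z : QuotSMulTop a B) = 0 ↔ a ∣ z := by
        intro z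
        rw [Submodule.Quotient.mk_eq_zero, Submodule.mem_smul_pointwise_iff_exists]
        constructor
        · rintro ⟨w, -, rfl⟩; exact ⟨w, rfl⟩
        · rintro ⟨w, rfl⟩; exact ⟨w, trivial, rfl⟩
      rw [← hmk]
      apply hb
      change b • (Submodule.Quotient.mk x : QuotSMulTop a B) = b • 0
      rw [smul_zero, ← Submodule.Quotient.mk_smul, hmk]
      exact ⟨y, hy⟩

theorem aux_localization {A : Type*} [CommRing A] [IsNoetherianRing A] (q : Ideal A) [q.IsPrime]
    (I1 I2 : Ideal A)
    (h12 : ∀ Q : Ideal A, Q.IsPrime → I1 ≤ Q ∨ I2 ≤ Q)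
    (hm : ∀ Q : Ideal A, Q.IsPrime → Q ≤ q → I1 ≤ Q → I2 ≤ Q → Q = q)
    (h1 : ∃ Q : Ideal A, Q.IsPrime ∧ Q < q ∧ I1 ≤ Q)
    (h2 : ∃ Q : Ideal A, Q.IsPrime ∧ Q < q ∧ I2 ≤ Q) :
    ¬ 2 ≤ localDepth (Localization.AtPrime q) := by
  intro h
  obtain ⟨a, b, ha, hb, hra, hrb⟩ := aux_depth h
  have : IsNoetherianRing (Localization.AtPrime q) :=
    IsLocalization.isNoetherianRing q.primeCompl _ inferInstance
  let e := IsLocalization.AtPrime.orderIsoOfPrime (Localization.AtPrime q) q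
  have hec : ∀ Q, (e Q).1 = Ideal.comap (algebraMap A (Localization.AtPrime q)) Q.1 := fun Q => rfl
  have hpush : ∀ I : Ideal A, (∃ Q : Ideal A, Q.IsPrime ∧ Q < q ∧ I ≤ Q) →
      ¬ (∀ Q : Ideal (Localization.AtPrime q), Q.IsPrime →
        I.map (algebraMap A (Localization.AtPrime q)) ≤ Q →
          Q = IsLocalRing.maximalIdeal (Localization.AtPrime q)) := by
    rintro I ⟨Q, hQ, hlt, hI⟩ hall
    have hc : Ideal.comap (algebraMap A (Localization.AtPrime q))
        (e.symm ⟨Q, hQ, hlt.le⟩).1 = Q := by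
      rw [← hec, e.apply_symm_apply]
    have := hall (e.symm ⟨Q, hQ, hlt.le⟩).1 (e.symm ⟨Q, hQ, hlt.le⟩).2
      (by rw [Ideal.map_le_iff_le_comap, hc]; exact hI)
    rw [this] at hc
    have hcm : Ideal.comap (algebraMap A (Localization.AtPrime q)) (IsLocalRing.maximalIdeal (Localization.AtPrime q)) = q :=
      Localization.AtPrime.under_maximalIdeal
    rw [hcm] at hc
    exact hlt.ne hc.symm
  have hle : ∀ Q : Ideal (Localization.AtPrime q), Q.IsPrime →
      Ideal.comap (algebraMap A (Localization.AtPrime q)) Q ≤ q := fun Q hQ => (e ⟨Q, hQ⟩).2.2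
  rcases aux_local ha hb hra hrb (I1.map (algebraMap A (Localization.AtPrime q)))
    (I2.map (algebraMap A (Localization.AtPrime q))) (fun Q hQ => by
      rw [Ideal.map_le_iff_le_comap, Ideal.map_le_iff_le_comap]
      exact h12 _ (Ideal.IsPrime.comap _)) (fun Q hQ e1 e2 => by
      rw [Ideal.map_le_iff_le_comap] at e1 e2
      have := hm _ (Ideal.IsPrime.comap _) (hle Q hQ) e1 e2
      have hh : e ⟨Q, hQ⟩ = e ⟨IsLocalRing.maximalIdeal _, inferInstance⟩ := by
        apply Subtype.ext
        rw [hec, hec, this]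
        exact Localization.AtPrime.under_maximalIdeal.symm
      exact congrArg Subtype.val (e.injective hh)) with h | h
  · exact hpush I1 h1 h
  · exact hpush I2 h2 h

theorem aux_abstract {A R G : Type*} [CommRing A] [IsNoetherianRing A] [CommRing R] [Finite G]
    (ι : R →+* A) (π : G → A →+* R) (hπ : ∀ τ r, π τ (ι r) = r)
    (hcov : ∀ Q : Ideal A, Q.IsPrime → ∃ τ, RingHom.ker (π τ) ≤ Q)
    (H : Set G) (q0 : Ideal A) (hq0 : q0.IsPrime)
    (h1 : ∃ τ ∈ H, RingHom.ker (π τ) ≤ q0) (h2 : ∃ τ ∉ H, RingHom.ker (π τ) ≤ q0)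
    (k : ℕ) (hdim : ∀ q : PrimeSpectrum A, ∀ τ ∈ H, ∀ τ' ∉ H, RingHom.ker (π τ) ≤ q.asIdeal →
      RingHom.ker (π τ') ≤ q.asIdeal → (k : ℕ∞) + 1 < Order.height (PrimeSpectrum.comap ι q))
    (hcm : cmdefLE A k) : False := by
  classical
  have := Fintype.ofFinite G
  let I1 : Ideal A := (Finset.univ.filter (· ∈ H)).inf fun τ => RingHom.ker (π τ)
  let I2 : Ideal A := (Finset.univ.filter (· ∉ H)).inf fun τ => RingHom.ker (π τ)
  have hI1 : ∀ Q : Ideal A, Q.IsPrime → (I1 ≤ Q ↔ ∃ τ ∈ H, RingHom.ker (π τ) ≤ Q) := by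
    intro Q hQ
    rw [hQ.inf_le']; simp
  have hI2 : ∀ Q : Ideal A, Q.IsPrime → (I2 ≤ Q ↔ ∃ τ ∉ H, RingHom.ker (π τ) ≤ Q) := by
    intro Q hQ
    rw [hQ.inf_le']; simp
  have hle0 : I1 ⊔ I2 ≤ q0 := sup_le ((hI1 _ hq0).2 h1) ((hI2 _ hq0).2 h2)
  obtain ⟨q, hq, -⟩ := Ideal.exists_minimalPrimes_le hle0
  have hqp : q.IsPrime := hq.1.1
  obtain ⟨τ, hτ, hτq⟩ := (hI1 _ hqp).1 (le_sup_left.trans hq.1.2)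
  obtain ⟨τ', hτ', hτq'⟩ := (hI2 _ hqp).1 (le_sup_right.trans hq.1.2)
  let p : PrimeSpectrum R := PrimeSpectrum.comap ι ⟨q, hqp⟩
  have hht := hdim ⟨q, hqp⟩ τ hτ τ' hτ' hτq hτq'
  have hqeq : ∀ σ, RingHom.ker (π σ) ≤ q → PrimeSpectrum.comap (π σ) p = ⟨q, hqp⟩ := by
    intro σ hσ
    ext t
    have hk : t - ι (π σ t) ∈ q := hσ (by rw [RingHom.mem_ker, map_sub, hπ, sub_self])
    change ι (π σ t) ∈ q ↔ t ∈ q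
    exact ⟨fun h => by simpa using q.add_mem hk h, fun h => by simpa using q.sub_mem h hk⟩
  have hmono : ∀ σ, StrictMono (PrimeSpectrum.comap (π σ)) := by
    intro σ
    have hinj : Function.Injective (PrimeSpectrum.comap (π σ)) :=
      PrimeSpectrum.comap_injective_of_surjective _ (fun r => ⟨ι r, hπ σ r⟩)
    refine Monotone.strictMono_of_injective ?_ hinj
    intro x y hxy
    exact Ideal.comap_mono hxy
  have hdimA : Order.height p ≤ Order.height (⟨q, hqp⟩ : PrimeSpectrum A) := by
    have := Order.height_le_height_apply_of_strictMono _ (hmono τ) p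
    rwa [hqeq τ hτq] at this
  obtain ⟨p', hp'⟩ : ∃ p', p' < p := by
    have : Order.height p ≠ 0 := by
      intro h0
      change _ < Order.height p at hht
      rw [h0] at hht; exact not_lt_zero hht
    rw [ne_eq, Order.height_eq_zero, isMin_iff_forall_not_lt] at this
    push Not at this
    exact this
  have hsmall : ∀ σ, RingHom.ker (π σ) ≤ q →
      ∃ Q : Ideal A, Q.IsPrime ∧ Q < q ∧ RingHom.ker (π σ) ≤ Q := by
    intro σ hσ
    refine ⟨(PrimeSpectrum.comap (π σ) p').asIdeal, (PrimeSpectrum.comap (π σ) p').2, ?_, ?_⟩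
    · have := hmono σ hp'
      rw [hqeq σ hσ] at this
      exact this
    · intro t ht
      change π σ t ∈ p'.asIdeal
      rw [RingHom.mem_ker.mp ht]; exact p'.asIdeal.zero_mem
  refine aux_localization q I1 I2 ?_ ?_ ?_ ?_ ?_
  · intro Q hQ
    obtain ⟨σ, hσ⟩ := hcov Q hQ
    by_cases h : σ ∈ H
    · exact Or.inl ((hI1 Q hQ).2 ⟨σ, h, hσ⟩)
    · exact Or.inr ((hI2 Q hQ).2 ⟨σ, h, hσ⟩)
  · intro Q hQ hQq e1 e2
    exact le_antisymm hQq (hq.2 ⟨hQ, sup_le e1 e2⟩ hQq)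
  · obtain ⟨Q, hQ, hlt, hk⟩ := hsmall τ hτq
    exact ⟨Q, hQ, hlt, (hI1 Q hQ).2 ⟨τ, hτ, hk⟩⟩
  · obtain ⟨Q, hQ, hlt, hk⟩ := hsmall τ' hτq'
    exact ⟨Q, hQ, hlt, (hI2 Q hQ).2 ⟨τ', hτ', hk⟩⟩
  · have hc := hcm ⟨q, hqp⟩
    rw [IsLocalization.AtPrime.ringKrullDim_eq_height q, WithBot.coe_le_coe] at hc
    have e : q.height = Order.height (⟨q, hqp⟩ : PrimeSpectrum A) := by
      exact PrimeSpectrum.height_eq_orderHeight ⟨q, hqp⟩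
    rw [e] at hc
    have h3 := (hht.trans_le hdimA).trans_le hc
    change _ < localDepth (Localization.AtPrime q) + _ at h3
    generalize localDepth (Localization.AtPrime q) = d at h3
    induction d using ENat.recTopCoe with
    | top => exact le_top
    | coe d =>
      have : k + 1 < d + k := by exact_mod_cast h3
      have : 2 ≤ d := by omega
      exact_mod_cast this

theorem aux_poly {K R G D : Type*} [Field K] [CommRing R] [Algebra K R] [Group G] [Finite G]
    [CommRing D] [IsDomain D] (φ : G →* (R ≃ₐ[K] R)) (α β : R →+* D)
    (hαβ : ∀ f, (∀ τ, φ τ f = f) → α f = β f) (f : R) : ∃ τ, α (φ τ f) = β f := by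
  classical
  have := Fintype.ofFinite G
  let F : Polynomial R := ∏ τ : G, (Polynomial.X - Polynomial.C (φ τ f))
  have hF : ∀ σ : G, F.map (φ σ).toAlgHom.toRingHom = F := by
    intro σ
    simp only [F, Polynomial.map_prod, Polynomial.map_sub, Polynomial.map_X, Polynomial.map_C]
    refine Fintype.prod_equiv (Equiv.mulLeft σ) _ _ ?_
    intro τ
    simp
  have hmap : F.map α = F.map β := by
    ext n
    rw [Polynomial.coeff_map, Polynomial.coeff_map]
    refine hαβ _ ?_
    intro τ
    conv_rhs => rw [← hF τ, Polynomial.coeff_map]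
    rfl
  have h0 : Polynomial.eval f F = 0 := by
    rw [Polynomial.eval_prod]
    exact Finset.prod_eq_zero (Finset.mem_univ 1) (by simp)
  have h1 : Polynomial.eval (β f) (F.map α) = 0 := by
    rw [hmap, Polynomial.eval_map_apply, h0, map_zero]
  simp only [F, Polynomial.map_prod, Polynomial.map_sub, Polynomial.map_X, Polynomial.map_C,
    Polynomial.eval_prod, Polynomial.eval_sub, Polynomial.eval_X, Polynomial.eval_C] at h1
  obtain ⟨τ, -, hτ⟩ := Finset.prod_eq_zero_iff.mp h1
  exact ⟨τ, (sub_eq_zero.mp hτ).symm⟩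

theorem aux_codim {A : Type*} [CommRing A] (Z : Set (PrimeSpectrum A)) (p : PrimeSpectrum A)
    (hp : p ∈ Z) : codimIn Set.univ Z ≤ Order.height p := by
  unfold codimIn
  refine (iInf_le _ ⟨⟨p, Set.mem_univ _⟩, hp⟩).trans ?_
  exact Order.height_le_height_apply_of_strictMono
    (fun z : ↥(Set.univ : Set (PrimeSpectrum A)) => (z : PrimeSpectrum A))
    (fun _ _ h => h) ⟨p, Set.mem_univ _⟩

end Helpers

section Statements

variable {K R G : Type*} [Field K] [IsAlgClosed K] [CommRing R] [IsReduced R] [Nontrivial R]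
  [Algebra K R] [Group G] [Finite G]

/-- If X is connected, G is generated by elements having a fixed
point, and some ideal J with √J = √I_sep satisfies cmdef((K[X] ⊗ K[X])/J) ≤ k, then G is
generated by (k+1)-reflections. -/
theorem generated_by_reflections_of_cmdef (hfg : Algebra.FiniteType K R)
    (φ : G →* (R ≃ₐ[K] R))
    (hconn : IsConnected (Set.univ : Set (PrimeSpectrum R)))
    (hgen : Subgroup.closure {σ : G | HasFixedPoint K R G φ σ} = ⊤)
    (k : ℕ∞)
    (hk : ∃ J : Ideal (R ⊗[K] R), J.radical = (sepIdeal K R G φ).radical ∧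
      cmdefLE ((R ⊗[K] R) ⧸ J) k) :
    Subgroup.closure {σ : G | IsKReflection K R G φ (k + 1) σ} = ⊤ := by
  classical
  have := Fintype.ofFinite G
  obtain ⟨J, hJ, hcm⟩ := hk
  induction k using ENat.recTopCoe with
  | top =>
    rw [eq_top_iff]
    intro σ _
    apply Subgroup.subset_closure
    simp [IsKReflection]
  | coe k =>
  by_contra hne
  set H := Subgroup.closure {σ : G | IsKReflection K R G φ ((k : ℕ∞) + 1) σ} with hH
  obtain ⟨σ₀, ⟨x, hx⟩, hσ₀⟩ : ∃ σ : G, HasFixedPoint K R G φ σ ∧ σ ∉ H := by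
    by_contra hcon
    push Not at hcon
    apply hne
    rw [eq_top_iff, ← hgen, Subgroup.closure_le]
    exact fun σ hσ => hcon σ hσ
  have hnoeT : IsNoetherianRing (R ⊗[K] R) := by
    have : Algebra.FiniteType K (R ⊗[K] R) :=
      Algebra.FiniteType.trans (S := R) hfg inferInstance
    exact Algebra.FiniteType.isNoetherianRing K _
  let πT : G → (R ⊗[K] R →ₐ[K] R) := fun τ =>
    Algebra.TensorProduct.productMap (AlgHom.id K R) (φ τ).toAlgHom
  have hπT : ∀ τ a b, πT τ (a ⊗ₜ b) = a * φ τ b := fun τ a b => by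
    simp [πT]
  have hsep : ∀ τ, sepIdeal K R G φ ≤ RingHom.ker (πT τ).toRingHom := by
    intro τ
    rw [sepIdeal, Ideal.span_le]
    rintro _ ⟨f, hf, rfl⟩
    change πT τ (f ⊗ₜ[K] (1 : R) - (1 : R) ⊗ₜ[K] f) = 0
    have hf' : φ τ f = f := hf τ
    rw [map_sub, hπT, hπT, hf']; simp
  have hJker : ∀ τ, J ≤ RingHom.ker (πT τ).toRingHom := by
    intro τ t ht
    have : t ∈ (sepIdeal K R G φ).radical := hJ ▸ Ideal.le_radical ht
    obtain ⟨n, hn⟩ := this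
    have h0 : πT τ (t ^ n) = 0 := hsep τ hn
    rw [map_pow] at h0
    exact eq_zero_of_pow_eq_zero h0
  let π : G → ((R ⊗[K] R) ⧸ J →+* R) := fun τ =>
    Ideal.Quotient.lift J (πT τ).toRingHom (fun t ht => hJker τ ht)
  have hπ : ∀ τ t, π τ (Ideal.Quotient.mk J t) = πT τ t := fun τ t => rfl
  let ι : R →+* (R ⊗[K] R) ⧸ J :=
    (Ideal.Quotient.mk J).comp (Algebra.TensorProduct.includeLeft (R := K) (S := K)).toRingHom
  have hι : ∀ r, ι r = Ideal.Quotient.mk J (r ⊗ₜ 1) := fun r => rfl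
  let ι' : R →+* (R ⊗[K] R) ⧸ J :=
    (Ideal.Quotient.mk J).comp (Algebra.TensorProduct.includeRight (R := K)).toRingHom
  have hι' : ∀ r, ι' r = Ideal.Quotient.mk J (1 ⊗ₜ r) := fun r => rfl
  have hker : ∀ τ f, ι (φ τ f) - ι' f ∈ RingHom.ker (π τ) := by
    intro τ f
    rw [RingHom.mem_ker, map_sub, hι, hι', hπ, hπ, hπT, hπT]; simp
  have hinv : ∀ Q : Ideal ((R ⊗[K] R) ⧸ J), Q.IsPrime → ∀ f, (∀ τ, φ τ f = f) →
      ι f - ι' f ∈ Q := by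
    intro Q hQ f hf
    have : deltaMap K R f ∈ J.radical := by
      rw [hJ]; exact Ideal.le_radical (Ideal.subset_span ⟨f, hf, rfl⟩)
    obtain ⟨n, hn⟩ := this
    refine hQ.mem_of_pow_mem n ?_
    have e : ι f - ι' f = Ideal.Quotient.mk J (deltaMap K R f) := by
      rw [deltaMap, map_sub, hι, hι']
    rw [e, ← map_pow, Ideal.Quotient.eq_zero_iff_mem.mpr hn]
    exact Q.zero_mem
  have hcov : ∀ Q : Ideal ((R ⊗[K] R) ⧸ J), Q.IsPrime → ∃ τ, RingHom.ker (π τ) ≤ Q := by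
    intro Q hQ
    let V : G → Subspace K R := fun τ =>
      { carrier := {f | ι (φ τ f) - ι' f ∈ Q}
        zero_mem' := by simp
        add_mem' := by
          intro a b ha hb
          have := Q.add_mem ha hb
          simp only [Set.mem_ofPred_eq, map_add]
          convert this using 1; ring
        smul_mem' := by
          intro c a ha
          have := Q.mul_mem_left (algebraMap K _ c) ha
          have e1 : ι (φ τ (c • a)) = algebraMap K _ c * ι (φ τ a) := by
            rw [map_smul, hι, hι, ← TensorProduct.smul_tmul', ← Algebra.smul_def]; rfl
          have e2 : ι' (c • a) = algebraMap K _ c * ι' a := by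
            rw [hι', hι', TensorProduct.tmul_smul, ← Algebra.smul_def]; rfl
          change ι (φ τ (c • a)) - ι' (c • a) ∈ Q
          rw [e1, e2, ← mul_sub]; exact this }
    have hV : ∀ τ f, f ∈ V τ ↔ ι (φ τ f) - ι' f ∈ Q := fun τ f => Iff.rfl
    have hun : ⋃ τ, (V τ : Set R) = Set.univ := by
      rw [Set.eq_univ_iff_forall]
      intro f
      have hdom : IsDomain (((R ⊗[K] R) ⧸ J) ⧸ Q) := Ideal.Quotient.isDomain Q
      obtain ⟨τ, hτ⟩ := aux_poly (D := ((R ⊗[K] R) ⧸ J) ⧸ Q) φ ((Ideal.Quotient.mk Q).comp ι) ((Ideal.Quotient.mk Q).comp ι')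
        (by intro f hf; exact Ideal.Quotient.eq.mpr (hinv Q hQ f hf)) f
      rw [Set.mem_iUnion]
      exact ⟨τ, Ideal.Quotient.eq.mp hτ⟩
    obtain ⟨τ, hτ⟩ := Subspace.exists_eq_top_of_iUnion_eq_univ hun
    refine ⟨τ, ?_⟩
    have key : ∀ t : R ⊗[K] R, Ideal.Quotient.mk J t - ι (πT τ t) ∈ Q := by
      intro t
      induction t using TensorProduct.induction_on with
      | zero => simp
      | add a b ha hb =>
        have := Q.add_mem ha hb
        simp only [map_add]
        convert this using 1; ring
      | tmul a b =>
        have hb : ι (φ τ b) - ι' b ∈ Q := (hV τ b).1 (by rw [hτ]; trivial)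
        have e : Ideal.Quotient.mk J (a ⊗ₜ[K] b) = ι a * ι' b := by
          rw [hι, hι', ← map_mul]; simp
        rw [hπT, map_mul, e, ← mul_sub]
        apply Q.mul_mem_left
        rw [← neg_sub]
        exact Q.neg_mem hb
    intro a ha
    obtain ⟨t, rfl⟩ := Ideal.Quotient.mk_surjective a
    have := key t
    rw [RingHom.mem_ker, hπ] at ha
    rw [ha] at this
    simpa using this
  have hq : ∀ a, x (π 1 a) = x (π σ₀ a) := by
    intro a
    obtain ⟨t, rfl⟩ := Ideal.Quotient.mk_surjective a
    rw [hπ, hπ]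
    induction t using TensorProduct.induction_on with
    | zero => simp
    | add a b ha hb => simp only [map_add, ha, hb]
    | tmul a b => rw [hπT, hπT, map_mul, map_mul, hx]; simp
  refine aux_abstract ι π ?_ hcov (H : Set G)
    (RingHom.ker (x.toRingHom.comp (π 1))) (RingHom.ker_isPrime _) ?_ ?_ k ?_ hcm
  · intro τ r
    rw [hι, hπ, hπT]; simp
  · refine ⟨1, H.one_mem, ?_⟩
    intro a ha
    change x (π 1 a) = 0
    rw [RingHom.mem_ker.mp ha, map_zero]
  · refine ⟨σ₀, hσ₀, ?_⟩
    intro a ha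
    change x (π 1 a) = 0
    rw [hq, RingHom.mem_ker.mp ha, map_zero]
  · intro q τ hτ τ' hτ' hk1 hk2
    have hσ : τ' * τ⁻¹ ∉ H := by
      intro h
      apply hτ'
      have := H.mul_mem h hτ
      simpa using this
    have hnr : ¬ IsKReflection K R G φ ((k : ℕ∞) + 1) (τ' * τ⁻¹) := fun h =>
      hσ (Subgroup.subset_closure h)
    rw [IsKReflection, not_le] at hnr
    refine hnr.trans_le ?_
    have hmem : PrimeSpectrum.comap ι q ∈
        zeroLocus (reflIdeal K R G φ (τ' * τ⁻¹) : Set R) := by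
      rw [PrimeSpectrum.mem_zeroLocus, SetLike.coe_subset_coe, reflIdeal, Ideal.span_le]
      rintro _ ⟨g, rfl⟩
      change ι (φ (τ' * τ⁻¹) g - g) ∈ q.asIdeal
      have e1 := hk1 (hker τ (φ τ⁻¹ g))
      have e2 := hk2 (hker τ' (φ τ⁻¹ g))
      have := q.asIdeal.sub_mem e2 e1
      have e3 : φ τ (φ τ⁻¹ g) = g := by
        rw [← AlgEquiv.mul_apply, ← map_mul]; simp
      rw [e3, ← AlgEquiv.mul_apply, ← map_mul] at this
      rw [map_sub]
      convert this using 1; ring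
    exact aux_codim _ _ hmem

end Statements
end Defs
end
end

section
/- Assume the affine G-variety X is connected and Cohen-Macaulay and G is generated by elements having a fixed point in X. If there exists a separating set of invariants of size n = dim(X) (i.e., γ_sep = n), then G is generated by reflections (1-reflections) on X. -/
noncomputable section

open TensorProduct PrimeSpectrum

section Defs

variable (K R G : Type*) [Field K] [CommRing R] [Algebra K R] [Group G]

/-! ### Part 1: regular elements in Noetherian local rings -/

def RegOn {L : Type*} [CommRing L] (Q : Ideal L) (y : L) : Prop := ∀ z, y * z ∈ Q → z ∈ Q

def Dep {L : Type*} [CommRing L] [IsLocalRing L] : ℕ → Ideal L → Prop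
  | 0, _ => True
  | n + 1, Q => ∃ y ∈ IsLocalRing.maximalIdeal L, RegOn Q y ∧ Dep n (Q ⊔ Ideal.span {y})

def RegList {L : Type*} [CommRing L] : Ideal L → List L → Prop
  | _, [] => True
  | Q, f :: fs => RegOn Q f ∧ RegList (Q ⊔ Ideal.span {f}) fs

theorem mem_sup_span {L : Type*} [CommRing L] {Q : Ideal L} {y v : L} :
    v ∈ Q ⊔ Ideal.span {y} ↔ ∃ q ∈ Q, ∃ t, v = q + y * t := by
  rw [Submodule.mem_sup]
  constructor
  · rintro ⟨q, hq, z, hz, rfl⟩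
    obtain ⟨t, rfl⟩ := Ideal.mem_span_singleton'.1 hz
    exact ⟨q, hq, t, by ring⟩
  · rintro ⟨q, hq, t, rfl⟩
    exact ⟨q, hq, y * t, Ideal.mem_span_singleton'.2 ⟨t, by ring⟩, rfl⟩

theorem regOn_swap_right {L : Type*} [CommRing L] {Q : Ideal L} {y z : L}
    (hy : RegOn Q y) (hz : RegOn (Q ⊔ Ideal.span {y}) z) : RegOn (Q ⊔ Ideal.span {z}) y := by
  intro w hw
  obtain ⟨q, hq, v, hv⟩ := mem_sup_span.1 hw
  have h1 : v ∈ Q ⊔ Ideal.span {y} :=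
    hz v (mem_sup_span.2 ⟨-q, Q.neg_mem hq, w, by linear_combination -hv⟩)
  obtain ⟨q', hq', v', rfl⟩ := mem_sup_span.1 h1
  have h2 : w - z * v' ∈ Q := by
    apply hy
    have : y * (w - z * v') = q + z * q' := by linear_combination hv
    rw [this]
    exact Q.add_mem hq (Q.mul_mem_left _ hq')
  exact mem_sup_span.2 ⟨_, h2, v', by ring⟩

theorem regOn_swap_left {L : Type*} [CommRing L] [IsLocalRing L] [IsNoetherianRing L]
    {Q : Ideal L} {y z : L} (hym : y ∈ IsLocalRing.maximalIdeal L)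
    (hy : RegOn Q y) (hz : RegOn (Q ⊔ Ideal.span {y}) z) : RegOn Q z := by
  let N : Ideal L := Q.colon {z}
  have hN : ∀ w, w ∈ N ↔ z * w ∈ Q := fun w => by
    simp [N, Submodule.mem_colon_singleton, mul_comm]
  have hle : N ≤ Q := by
    apply Submodule.le_of_le_smul_of_le_jacobson_bot (I := IsLocalRing.maximalIdeal L)
      (IsNoetherian.noetherian N) (IsLocalRing.maximalIdeal_le_jacobson _)
    intro w hw
    rw [hN] at hw
    have h1 : w ∈ Q ⊔ Ideal.span {y} := hz w (mem_sup_span.2 ⟨_, hw, 0, by ring⟩)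
    obtain ⟨q, hq, t, rfl⟩ := mem_sup_span.1 h1
    refine Submodule.add_mem_sup hq (Submodule.smul_mem_smul hym ?_)
    rw [hN]
    apply hy
    have : y * (z * t) = z * (q + y * t) - z * q := by ring
    rw [this]
    exact Q.sub_mem hw (Q.mul_mem_left _ hq)
  intro w hw
  exact hle ((hN w).2 hw)

theorem exchange_one {L : Type*} [CommRing L] {Q m : Ideal L} {y z f : L}
    (hym : y ∈ m) (hzm : z ∈ m)
    (hy : RegOn Q y) (hz : RegOn (Q ⊔ Ideal.span {y}) z) (hf : RegOn Q f) :
    ∀ w ∉ Q ⊔ Ideal.span {f}, ∃ r ∈ m, r * w ∉ Q ⊔ Ideal.span {f} := by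
  intro w hw
  by_contra! H
  obtain ⟨q, hq, v, hv⟩ := mem_sup_span.1 (H y hym)
  obtain ⟨q2, hq2, v2, hv2⟩ := mem_sup_span.1 (H z hzm)
  have h1 : z * v - y * v2 ∈ Q := by
    apply hf
    have : f * (z * v - y * v2) = y * q2 - z * q := by linear_combination - z * hv + y * hv2
    rw [this]
    exact Q.sub_mem (Q.mul_mem_left _ hq2) (Q.mul_mem_left _ hq)
  have h2 := hz v (mem_sup_span.2 ⟨_, h1, v2, by ring⟩)
  obtain ⟨q', hq', v', rfl⟩ := mem_sup_span.1 h2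
  have h3 : w - f * v' ∈ Q := by
    apply hy
    have : y * (w - f * v') = q + f * q' := by linear_combination hv
    rw [this]
    exact Q.add_mem hq (Q.mul_mem_left _ hq')
  exact hw (mem_sup_span.2 ⟨_, h3, v', by ring⟩)

theorem not_regOn_iff {L : Type*} [CommRing L] [IsNoetherianRing L] {Q : Ideal L} {z : L} :
    RegOn Q z ↔ ∀ p ∈ associatedPrimes L (L ⧸ Q), z ∉ p := by
  have h := biUnion_associatedPrimes_eq_zero_divisors L (L ⧸ Q)
  have h2 : z ∈ (⋃ p ∈ associatedPrimes L (L ⧸ Q), (p : Set L)) ↔ ¬ RegOn Q z := by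
    rw [h]
    simp only [Set.mem_ofPred_eq, RegOn]
    push Not
    constructor
    · rintro ⟨x, hx, hx2⟩
      obtain ⟨w, rfl⟩ := Ideal.Quotient.mk_surjective x
      refine ⟨w, ?_, ?_⟩
      · rw [← Ideal.Quotient.eq_zero_iff_mem, map_mul]; exact hx2
      · rwa [Ne, Ideal.Quotient.eq_zero_iff_mem] at hx
    · rintro ⟨w, hw, hw2⟩
      refine ⟨Ideal.Quotient.mk Q w, ?_, ?_⟩
      · rwa [Ne, Ideal.Quotient.eq_zero_iff_mem]
      · rw [← Ideal.Quotient.eq_zero_iff_mem, map_mul] at hw; exact hw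
  simp only [Set.mem_iUnion, SetLike.mem_coe] at h2
  rw [← not_iff_not, ← h2]
  push Not
  simp

theorem assoc_colon {L : Type*} [CommRing L] [IsNoetherianRing L] {Q p : Ideal L}
    (hp : p ∈ associatedPrimes L (L ⧸ Q)) :
    p.IsPrime ∧ ∃ w ∉ Q, ∀ r, r ∈ p ↔ r * w ∈ Q := by
  have hp' : IsAssociatedPrime p (L ⧸ Q) := hp
  have h1 := hp'.isPrime
  refine ⟨h1, ?_⟩
  obtain ⟨_, x, hx⟩ := isAssociatedPrime_iff.1 hp'
  obtain ⟨w, rfl⟩ := Ideal.Quotient.mk_surjective x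
  have h2 : ∀ r, r ∈ p ↔ r * w ∈ Q := by
    intro r
    rw [hx, ← Ideal.Quotient.eq_zero_iff_mem (I := Q), map_mul]
    simp [Submodule.mem_colon_singleton, Algebra.smul_def]
  refine ⟨w, fun hw => ?_, h2⟩
  apply h1.ne_top
  rw [Ideal.eq_top_iff_one, h2]
  simpa using hw

theorem exists_regOn_of {L : Type*} [CommRing L] [IsNoetherianRing L] {m Q Q' : Ideal L}
    (h1 : ∀ p ∈ associatedPrimes L (L ⧸ Q), ¬ m ≤ p)
    (h2 : ∀ p ∈ associatedPrimes L (L ⧸ Q'), ¬ m ≤ p) :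
    ∃ z ∈ m, RegOn Q z ∧ RegOn Q' z := by
  by_contra! H
  have hfin := (associatedPrimes.finite L (L ⧸ Q)).union (associatedPrimes.finite L (L ⧸ Q'))
  have hsub : (m : Set L) ⊆ ⋃ p ∈ (hfin.toFinset : Set (Ideal L)), (p : Set L) := by
    intro z hz
    by_contra hcon
    simp only [Set.mem_iUnion, not_exists] at hcon
    refine H z hz (not_regOn_iff.2 fun p hp hzp => hcon p ?_ hzp)
      (not_regOn_iff.2 fun p hp hzp => hcon p ?_ hzp)
    · simp [hp]
    · simp [hp]
  rw [Ideal.subset_union_prime ⊥ ⊥] at hsub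
  · obtain ⟨p, hp, hmp⟩ := hsub
    simp only [Set.Finite.mem_toFinset] at hp
    rcases hp with hp | hp
    · exact h1 p hp hmp
    · exact h2 p hp hmp
  · intro p hp _ _
    simp only [Set.Finite.mem_toFinset] at hp
    rcases hp with hp | hp
    · exact (assoc_colon hp).1
    · exact (assoc_colon hp).1

theorem not_le_assoc {L : Type*} [CommRing L] [IsNoetherianRing L] {m Q : Ideal L}
    (h : ∀ w ∉ Q, ∃ r ∈ m, r * w ∉ Q) : ∀ p ∈ associatedPrimes L (L ⧸ Q), ¬ m ≤ p := by
  intro p hp hmp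
  obtain ⟨_, w, hw, h2⟩ := assoc_colon hp
  obtain ⟨r, hr, hrw⟩ := h w hw
  exact hrw ((h2 r).1 (hmp hr))

theorem dep_exchange {L : Type*} [CommRing L] [IsLocalRing L] [IsNoetherianRing L] (n : ℕ) :
    ∀ (Q : Ideal L) (f : L), f ∈ IsLocalRing.maximalIdeal L → RegOn Q f → Dep (n + 1) Q →
      Dep n (Q ⊔ Ideal.span {f}) := by
  induction n with
  | zero => intros; trivial
  | succ n ih =>
    intro Q f hfm hf ⟨y, hym, hy, y2, hy2m, hy2, hD⟩
    obtain ⟨z, hzm, hz1, hz2⟩ := exists_regOn_of (m := IsLocalRing.maximalIdeal L)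
      (Q := Q ⊔ Ideal.span {y}) (Q' := Q ⊔ Ideal.span {f})
      (not_le_assoc fun w hw => ⟨y2, hy2m, fun h => hw (hy2 w h)⟩)
      (not_le_assoc (exchange_one hym hy2m hy hy2 hf))
    have h1 := ih _ z hzm hz1 ⟨y2, hy2m, hy2, hD⟩
    have hzQ := regOn_swap_left hym hy hz1
    have hyz := regOn_swap_right hy hz1
    have hfz := regOn_swap_right hf hz2
    have h2 : Dep (n + 1) (Q ⊔ Ideal.span {z}) := ⟨y, hym, hyz, by
      rwa [sup_right_comm]⟩
    have h3 := ih _ f hfm hfz h2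
    exact ⟨z, hzm, hz2, by rwa [sup_right_comm]⟩

theorem dep_chain {L : Type*} [CommRing L] [IsLocalRing L] [IsNoetherianRing L] (n : ℕ) :
    ∀ (Q : Ideal L) (p : PrimeSpectrum L), p.asIdeal ∈ associatedPrimes L (L ⧸ Q) → Dep n Q →
      ∃ l : LTSeries (PrimeSpectrum L), l.head = p ∧ l.length = n := by
  induction n with
  | zero => intro Q p _ _; exact ⟨RelSeries.singleton _ p, rfl, rfl⟩
  | succ n ih =>
    intro Q p hp ⟨y, hym, hy, hD⟩
    obtain ⟨_, w, hw, hwp⟩ := assoc_colon hp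
    let N : Ideal L := Q.colon (p.asIdeal : Set L)
    have hN : ∀ v, v ∈ N ↔ ∀ r ∈ p.asIdeal, r * v ∈ Q := fun v => by
      simp only [N, Submodule.mem_colon, smul_eq_mul, SetLike.mem_coe]
      simp only [mul_comm]
    have hex : ∃ v ∈ N, v ∉ Q ⊔ Ideal.span {y} := by
      by_contra! H
      apply hw
      have hle : N ≤ Q := by
        apply Submodule.le_of_le_smul_of_le_jacobson_bot (I := IsLocalRing.maximalIdeal L)
          (IsNoetherian.noetherian N) (IsLocalRing.maximalIdeal_le_jacobson _)
        intro v hv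
        obtain ⟨q, hq, t, rfl⟩ := mem_sup_span.1 (H v hv)
        refine Submodule.add_mem_sup hq (Submodule.smul_mem_smul hym ?_)
        rw [hN] at hv ⊢
        intro r hr
        apply hy
        have : y * (r * t) = r * (q + y * t) - r * q := by ring
        rw [this]
        exact Q.sub_mem (hv r hr) (Q.mul_mem_left _ hq)
      exact hle ((hN w).2 fun r hr => (hwp r).1 hr)
    obtain ⟨v, hv, hvy⟩ := hex
    have hv0 : (Ideal.Quotient.mk (Q ⊔ Ideal.span {y}) v) ≠ 0 := by
      rwa [Ne, Ideal.Quotient.eq_zero_iff_mem]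
    obtain ⟨P, hP, hle⟩ := exists_le_isAssociatedPrime_of_isNoetherianRing L
      (Ideal.Quotient.mk (Q ⊔ Ideal.span {y}) v) hv0
    have hmem : ∀ r, r * v ∈ Q ⊔ Ideal.span {y} → r ∈ P := by
      intro r hr
      apply hle
      rw [← Ideal.Quotient.eq_zero_iff_mem, map_mul] at hr
      simpa [Submodule.mem_colon_singleton, Algebra.smul_def] using hr
    have hlt : p < ⟨P, hP.isPrime⟩ := by
      rw [← PrimeSpectrum.asIdeal_lt_asIdeal]
      refine lt_of_le_of_ne (fun r hr => hmem r (le_sup_left (a := Q) ((hN v).1 hv r hr))) ?_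
      intro he
      have hyP : y ∈ P := hmem y (mem_sup_span.2 ⟨0, Q.zero_mem, v, by ring⟩)
      have hyp : y ∈ p.asIdeal := by rw [he]; exact hyP
      exact hw (hy w ((hwp y).1 hyp))
    obtain ⟨l, hl, hlen⟩ := ih _ ⟨P, hP.isPrime⟩ hP hD
    exact ⟨l.cons p (by rw [hl]; exact hlt), by simp, by simp [hlen]⟩

theorem dep_sop {L : Type*} [CommRing L] [IsLocalRing L] [IsNoetherianRing L] (fs : List L) :
    ∀ (Q : Ideal L), Dep fs.length Q → (∀ f ∈ fs, f ∈ IsLocalRing.maximalIdeal L) →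
      (∀ q : Ideal L, q.IsPrime → Q ≤ q → (∀ f ∈ fs, f ∈ q) → q = IsLocalRing.maximalIdeal L) →
      RegList Q fs := by
  induction fs with
  | nil => intros; trivial
  | cons f fs ih =>
    intro Q hD hm hq
    have hf : RegOn Q f := by
      rw [not_regOn_iff]
      intro p hp hfp
      obtain ⟨hpp, w, hw, hwp⟩ := assoc_colon hp
      obtain ⟨l, hl, hlen⟩ := dep_chain _ Q ⟨p, hpp⟩ hp hD
      have hQp : Q ≤ p := fun r hr => (hwp r).2 (Q.mul_mem_right _ hr)
      have hdim : ((fs.length + 1 : ℕ) : WithBot ℕ∞) ≤ ringKrullDim (L ⧸ p) := by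
        rw [ringKrullDim_quotient]
        let l' : LTSeries (PrimeSpectrum.zeroLocus (p : Set L)) :=
          ⟨l.length, fun i => ⟨l i, by
            have : l.head ≤ l i := LTSeries.head_le l i
            rw [hl] at this
            exact this⟩, fun i => l.step i⟩
        have := Order.LTSeries.length_le_krullDim l'
        have h3 : l'.length = fs.length + 1 := hlen
        rw [h3] at this
        exact this
      have : IsLocalRing (L ⧸ p) := IsLocalRing.of_surjective' (Ideal.Quotient.mk p)
        Ideal.Quotient.mk_surjective
      rw [← IsLocalRing.maximalIdeal_height_eq_ringKrullDim] at hdim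
      have hmin : IsLocalRing.maximalIdeal (L ⧸ p) ∈
          (Ideal.span ((Ideal.Quotient.mk p) '' {x | x ∈ fs})).minimalPrimes := by
        refine ⟨⟨inferInstance, ?_⟩, ?_⟩
        · rw [Ideal.span_le]
          rintro _ ⟨x, hx, rfl⟩
          rw [SetLike.mem_coe, IsLocalRing.mem_maximalIdeal, mem_nonunits_iff]
          intro hu
          have h5 : IsLocalHom (Ideal.Quotient.mk p) :=
            IsLocalHom.of_surjective _ Ideal.Quotient.mk_surjective
          exact (IsLocalRing.mem_maximalIdeal x).1 (hm x (List.mem_cons_of_mem _ hx))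
            (isUnit_of_map_unit (Ideal.Quotient.mk p) x hu)
        · rintro q ⟨hqp, hqs⟩ _
          have h4 := hq (q.comap (Ideal.Quotient.mk p)) (Ideal.comap_isPrime _ _) ?_ ?_
          · intro x hx
            obtain ⟨x, rfl⟩ := Ideal.Quotient.mk_surjective x
            have : x ∈ IsLocalRing.maximalIdeal L := by
              rw [IsLocalRing.mem_maximalIdeal, mem_nonunits_iff] at hx ⊢
              exact fun h => hx (h.map _)
            rw [← h4] at this
            exact this
          · intro x hx
            have : Ideal.Quotient.mk p x = 0 := Ideal.Quotient.eq_zero_iff_mem.2 (hQp hx)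
            simp [Ideal.mem_comap, this]
          · intro x hx
            rcases List.mem_cons.1 hx with rfl | hx
            · have : Ideal.Quotient.mk p x = 0 := Ideal.Quotient.eq_zero_iff_mem.2 hfp
              simp [Ideal.mem_comap, this]
            · exact hqs (Ideal.subset_span ⟨x, hx, rfl⟩)
      have hfin : ((Ideal.Quotient.mk p) '' {x | x ∈ fs}).Finite := (List.finite_toSet fs).image _
      have h6 := Ideal.height_le_card_of_mem_minimalPrimes_span hfin hmin
      have h7 : ((Ideal.Quotient.mk p) '' {x | x ∈ fs}).ncard ≤ fs.length := by
        classical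
        refine (Set.ncard_image_le (List.finite_toSet fs)).trans ?_
        have : {x | x ∈ fs} = (fs.toFinset : Set L) := by ext; simp
        rw [this, Set.ncard_coe_finset]
        exact List.toFinset_card_le fs
      have h8 := h6.trans (Nat.cast_le.2 h7)
      have h9 : ((fs.length + 1 : ℕ) : ℕ∞) ≤ fs.length := by
        refine le_trans ?_ h8
        exact_mod_cast hdim
      have : fs.length + 1 ≤ fs.length := by exact_mod_cast h9
      omega
    refine ⟨hf, ih _ (dep_exchange _ Q f (hm f (by simp)) hf hD)
      (fun g hg => hm g (List.mem_cons_of_mem _ hg)) ?_⟩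
    intro q hqp hQq hfq
    refine hq q hqp (le_sup_left.trans hQq) ?_
    intro g hg
    rcases List.mem_cons.1 hg with rfl | hg
    · exact hQq (mem_sup_span.2 ⟨0, Q.zero_mem, 1, by ring⟩)
    · exact hfq g hg

/-! ### Part 2: flatness of quotients -/

theorem mem_map_iff_sum {C D : Type*} [CommRing C] [CommRing D] [Algebra C D] {I : Ideal C} {d : D} :
    d ∈ I.map (algebraMap C D) ↔ ∃ (n : ℕ) (v : Fin n → C) (e : Fin n → D),
      (∀ i, v i ∈ I) ∧ d = ∑ i, v i • e i := by
  constructor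
  · intro h
    rw [Ideal.map, Ideal.span, Submodule.mem_span_set'] at h
    obtain ⟨n, f, g, rfl⟩ := h
    choose v hv hv2 using fun i => (g i).2
    refine ⟨n, v, f, hv, Finset.sum_congr rfl fun i _ => ?_⟩
    rw [← hv2 i, smul_eq_mul, Algebra.smul_def, mul_comm]
  · rintro ⟨n, v, e, hv, rfl⟩
    refine Ideal.sum_mem _ fun i _ => ?_
    rw [Algebra.smul_def]
    exact Ideal.mul_mem_right _ _ (Ideal.mem_map_of_mem _ (hv i))

theorem flat_colon {C D : Type*} [CommRing C] [CommRing D] [Algebra C D] [Module.Flat C D]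
    {I m : Ideal C} {u : C} (hu : ∀ c, u * c ∈ I → c ∈ m) {e : D}
    (he : u • e ∈ I.map (algebraMap C D)) : e ∈ m.map (algebraMap C D) := by
  obtain ⟨n, v, y, hv, hs⟩ := mem_map_iff_sum.1 he
  have hrel : ∑ i : Option (Fin n), (Option.elim i u (fun j => - v j) : C) •
      (Option.elim i e y : D) = 0 := by
    simp [Fintype.sum_option, hs]
  obtain ⟨κ, a, z, h1, h2⟩ := Module.Flat.isTrivialRelation_of_sum_smul_eq_zero (R := C) (M := D)
    (f := fun i : Option (Fin n) => Option.elim i u (fun j => - v j))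
    (x := fun i : Option (Fin n) => Option.elim i e y) hrel
  have h3 := h1 none
  simp only [Option.elim] at h3
  rw [h3]
  refine Ideal.sum_mem _ fun j _ => ?_
  rw [Algebra.smul_def]
  refine Ideal.mul_mem_right _ _ (Ideal.mem_map_of_mem _ (hu _ ?_))
  have h4 := h2 j
  rw [Fintype.sum_option] at h4
  simp only [Option.elim, neg_mul, Finset.sum_neg_distrib] at h4
  rw [add_neg_eq_zero] at h4
  rw [h4]
  exact Ideal.sum_mem _ fun i _ => I.mul_mem_right _ (hv i)

theorem regOn_map_primary {C D : Type*} [CommRing C] [CommRing D] [Algebra C D] [Module.Flat C D]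
    [IsNoetherianRing C] {m : Ideal C} [m.IsMaximal] {g : D}
    (hg : RegOn (m.map (algebraMap C D)) g) (k : ℕ) (I : Ideal C) :
    m ^ k ≤ I → RegOn (I.map (algebraMap C D)) g := by
  induction I using WellFoundedGT.induction with
  | ind I ih =>
  intro hk
  by_cases hI : I = ⊤
  · subst hI
    intro z _
    rw [Ideal.map_top]; trivial
  classical
  have hex : ∃ k, m ^ k ≤ I := ⟨k, hk⟩
  have hk1 := Nat.find_spec hex
  have hk0 : Nat.find hex ≠ 0 := by
    intro h0
    rw [h0, pow_zero, Ideal.one_eq_top, top_le_iff] at hk1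
    exact hI hk1
  obtain ⟨j, hj⟩ := Nat.exists_eq_succ_of_ne_zero hk0
  have hj2 : ¬ m ^ j ≤ I := Nat.find_min hex (by omega)
  rw [hj] at hk1
  obtain ⟨u, hu, huI⟩ := SetLike.not_le_iff_exists.1 hj2
  have hmu : ∀ c ∈ m, u * c ∈ I := fun c hc => hk1 (by
    rw [pow_succ]; exact Ideal.mul_mem_mul hu hc)
  have hcolon : ∀ c, u * c ∈ I → c ∈ m := by
    intro c hc
    by_contra hcm
    obtain ⟨a, i, hi, hai⟩ := Ideal.IsMaximal.exists_inv (inferInstance : m.IsMaximal) hcm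
    apply huI
    have : u = a * (u * c) + u * i := by linear_combination -u * hai
    rw [this]
    exact I.add_mem (I.mul_mem_left _ hc) (hmu i hi)
  have hlt : I < I ⊔ Ideal.span {u} := by
    refine lt_of_le_of_ne le_sup_left fun h => huI ?_
    rw [h]; exact mem_sup_span.2 ⟨0, I.zero_mem, 1, by ring⟩
  have h1 := ih _ hlt (hk.trans le_sup_left)
  intro d hd
  have h2 := h1 d (Ideal.map_mono le_sup_left hd)
  rw [Ideal.map_sup, Ideal.map_span, Set.image_singleton] at h2
  obtain ⟨d0, hd0, d1, rfl⟩ := mem_sup_span.1 h2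
  have h3 : g * d1 ∈ m.map (algebraMap C D) := by
    refine flat_colon (u := u) (I := I) hcolon ?_
    have : u • (g * d1) = g * (d0 + algebraMap C D u * d1) - g * d0 := by
      rw [Algebra.smul_def]; ring
    rw [this]
    exact Ideal.sub_mem _ hd (Ideal.mul_mem_left _ _ hd0)
  have h4 := hg _ h3
  refine Ideal.add_mem _ hd0 ?_
  obtain ⟨n, v, e, hv, rfl⟩ := mem_map_iff_sum.1 h4
  rw [Finset.mul_sum]
  refine Ideal.sum_mem _ fun i _ => ?_
  rw [Algebra.smul_def, ← mul_assoc, ← map_mul]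
  exact Ideal.mul_mem_right _ _ (Ideal.mem_map_of_mem _ (hmu _ (hv i)))

theorem mem_of_forall_sup_pow {D : Type*} [CommRing D] [IsLocalRing D] [IsNoetherianRing D]
    {J : Ideal D} {d : D} (h : ∀ k, d ∈ J ⊔ IsLocalRing.maximalIdeal D ^ k) : d ∈ J := by
  have h1 := Ideal.iInf_pow_smul_eq_bot_of_isLocalRing (M := D ⧸ J) (IsLocalRing.maximalIdeal D)
    (Ideal.IsPrime.ne_top inferInstance)
  rw [← Ideal.Quotient.eq_zero_iff_mem, ← Submodule.mem_bot (R := D), ← h1, Submodule.mem_iInf]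
  intro k
  obtain ⟨j, hj, x, hx, rfl⟩ := Submodule.mem_sup.1 (h k)
  have : Ideal.Quotient.mk J (j + x) = x • (1 : D ⧸ J) := by
    rw [map_add, Ideal.Quotient.eq_zero_iff_mem.2 hj, zero_add, Algebra.smul_def, mul_one]
    rfl
  rw [this]
  exact Submodule.smul_mem_smul hx trivial

theorem regOn_map {C D : Type*} [CommRing C] [CommRing D] [Algebra C D] [Module.Flat C D]
    [IsNoetherianRing C] [IsLocalRing D] [IsNoetherianRing D] {m : Ideal C} [m.IsMaximal]
    (hm : m.map (algebraMap C D) ≤ IsLocalRing.maximalIdeal D) {g : D}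
    (hg : RegOn (m.map (algebraMap C D)) g) (I : Ideal C) :
    RegOn (I.map (algebraMap C D)) g := by
  intro d hd
  refine mem_of_forall_sup_pow fun k => ?_
  have h := regOn_map_primary hg k (I ⊔ m ^ k) le_sup_right d (Ideal.map_mono le_sup_left hd)
  rw [Ideal.map_sup, Ideal.map_pow] at h
  exact sup_le_sup_left (Ideal.pow_right_mono hm k) _ h

theorem mk_mem_map_iff {C D : Type*} [CommRing C] [CommRing D] [Algebra C D] {Q : Ideal D}
    {I : Ideal C} {d : D} : Ideal.Quotient.mk Q d ∈ I.map (algebraMap C (D ⧸ Q)) ↔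
      d ∈ Q ⊔ I.map (algebraMap C D) := by
  have : algebraMap C (D ⧸ Q) = (Ideal.Quotient.mk Q).comp (algebraMap C D) := rfl
  rw [this, ← Ideal.map_map, ← Ideal.mem_comap,
    Ideal.comap_map_of_surjective _ Ideal.Quotient.mk_surjective, ← RingHom.ker_eq_comap_bot,
    Ideal.mk_ker, sup_comm]

theorem flat_of_surj {C E F : Type*} [CommRing C] [CommRing E] [Algebra C E] [CommRing F]
    [Algebra C F] [Module.Flat C E] {g : E} (key : ∀ I : Ideal C, RegOn (I.map (algebraMap C E)) g)
    (π : E →ₐ[C] F) (hπ : Function.Surjective π) (hπg : π g = 0)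
    (hker : ∀ z, π z = 0 → ∃ t, z = g * t) : Module.Flat C F := by
  rw [Module.Flat.iff_forall_isTrivialRelation]
  intro l f x hrel
  choose d hd using fun i => hπ (x i)
  obtain ⟨t, ht⟩ := hker (∑ i, f i • d i) (by
    rw [map_sum, ← hrel]
    exact Finset.sum_congr rfl fun i _ => by rw [map_smul, hd])
  have hI : t ∈ (Ideal.span (Set.range f)).map (algebraMap C E) := by
    apply key
    rw [← ht]
    refine Ideal.sum_mem _ fun i _ => ?_
    rw [Algebra.smul_def]
    exact Ideal.mul_mem_right _ _ (Ideal.mem_map_of_mem _ (Ideal.subset_span ⟨i, rfl⟩))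
  have hI2 : ∃ e : Fin l → E, t = ∑ i, f i • e i := by
    rw [Ideal.map_span, ← Set.range_comp, Ideal.mem_span_range_iff_exists_fun] at hI
    obtain ⟨e, he⟩ := hI
    refine ⟨e, he.symm.trans (Finset.sum_congr rfl fun i _ => ?_)⟩
    rw [Algebra.smul_def, mul_comm]; rfl
  obtain ⟨e, he⟩ := hI2
  have hrel2 : ∑ i, f i • (d i - g * e i) = 0 := by
    simp only [smul_sub, Finset.sum_sub_distrib, ht, he, Finset.mul_sum, mul_smul_comm, sub_self]
  obtain ⟨κ, a, y, h1, h2⟩ := Module.Flat.isTrivialRelation_of_sum_smul_eq_zero (R := C) (M := E)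
    (f := f) (x := fun i => d i - g * e i) hrel2
  refine ⟨κ, a, fun j => π (y j), fun i => ?_, h2⟩
  have h3 := congrArg π (h1 i)
  rw [map_sub, map_mul, hπg, zero_mul, sub_zero, hd, map_sum] at h3
  rw [h3]
  exact Finset.sum_congr rfl fun j _ => by rw [map_smul]

theorem flat_step {C D : Type*} [CommRing C] [CommRing D] [Algebra C D]
    [IsNoetherianRing C] [IsLocalRing D] [IsNoetherianRing D] {m : Ideal C} [m.IsMaximal]
    (hm : m.map (algebraMap C D) ≤ IsLocalRing.maximalIdeal D) (Q : Ideal D) (hQ : Q ≠ ⊤)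
    [Module.Flat C (D ⧸ Q)] {g : D}
    (hg : RegOn (Q ⊔ m.map (algebraMap C D)) g) : Module.Flat C (D ⧸ (Q ⊔ Ideal.span {g})) := by
  have : Nontrivial (D ⧸ Q) := Ideal.Quotient.nontrivial_iff.2 hQ
  have : IsLocalRing (D ⧸ Q) := IsLocalRing.of_surjective' (Ideal.Quotient.mk Q)
    Ideal.Quotient.mk_surjective
  have hm' : m.map (algebraMap C (D ⧸ Q)) ≤ IsLocalRing.maximalIdeal (D ⧸ Q) := by
    refine IsLocalRing.le_maximalIdeal fun h => ?_
    have h1 : Ideal.Quotient.mk Q 1 ∈ m.map (algebraMap C (D ⧸ Q)) := by rw [h]; trivial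
    rw [mk_mem_map_iff] at h1
    have h2 := sup_le (IsLocalRing.le_maximalIdeal hQ) hm h1
    exact (Ideal.ne_top_iff_one _).1 (Ideal.IsPrime.ne_top inferInstance) h2
  have hg' : RegOn (m.map (algebraMap C (D ⧸ Q))) (Ideal.Quotient.mk Q g) := by
    intro z hz
    obtain ⟨z, rfl⟩ := Ideal.Quotient.mk_surjective z
    rw [← map_mul, mk_mem_map_iff] at hz
    exact mk_mem_map_iff.2 (hg z hz)
  have key := fun I => regOn_map hm' hg' I
  refine flat_of_surj key (Ideal.Quotient.factorₐ C le_sup_left)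
    (Ideal.Quotient.factor_surjective le_sup_left) ?_ ?_
  · change Ideal.Quotient.mk (Q ⊔ Ideal.span {g}) g = 0
    rw [Ideal.Quotient.eq_zero_iff_mem]
    exact mem_sup_span.2 ⟨0, Q.zero_mem, 1, by ring⟩
  · intro z hz
    obtain ⟨z, rfl⟩ := Ideal.Quotient.mk_surjective z
    have hz' : Ideal.Quotient.mk (Q ⊔ Ideal.span {g}) z = 0 := hz
    rw [Ideal.Quotient.eq_zero_iff_mem] at hz'
    obtain ⟨q, hq, t, rfl⟩ := mem_sup_span.1 hz'
    refine ⟨Ideal.Quotient.mk Q t, ?_⟩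
    rw [map_add, Ideal.Quotient.eq_zero_iff_mem.2 hq, zero_add, map_mul]

theorem flat_list {C D : Type*} [CommRing C] [CommRing D] [Algebra C D]
    [IsNoetherianRing C] [IsLocalRing D] [IsNoetherianRing D] {m : Ideal C} [m.IsMaximal]
    (hm : m.map (algebraMap C D) ≤ IsLocalRing.maximalIdeal D) (gs : List D) :
    ∀ (Q : Ideal D), Q ≤ IsLocalRing.maximalIdeal D → (∀ g ∈ gs, g ∈ IsLocalRing.maximalIdeal D) →
    Module.Flat C (D ⧸ Q) → RegList (Q ⊔ m.map (algebraMap C D)) gs →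
    Module.Flat C (D ⧸ (Q ⊔ Ideal.span {x | x ∈ gs})) := by
  induction gs with
  | nil =>
    intro Q _ _ h _
    have : Q ⊔ Ideal.span {x | x ∈ ([] : List D)} = Q := by simp
    rw [this]; exact h
  | cons g gs ih =>
    intro Q hQ hgs hfl ⟨h1, h2⟩
    have h3 := flat_step hm Q (fun h => Ideal.IsPrime.ne_top
      (inferInstance : (IsLocalRing.maximalIdeal D).IsPrime) (top_le_iff.1 (h ▸ hQ))) h1
    have h4 := ih (Q ⊔ Ideal.span {g}) (sup_le hQ (by
      rw [Ideal.span_singleton_le_iff_mem]; exact hgs g (by simp)))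
      (fun x hx => hgs x (List.mem_cons_of_mem _ hx)) h3 (by rwa [sup_right_comm])
    have : {x | x ∈ g :: gs} = {g} ∪ {x | x ∈ gs} := by ext; simp
    rw [this, Ideal.span_union, ← sup_assoc]
    exact h4

/-! ### Part 3: dimension theory -/

theorem height_poly_aux {A : Type*} [CommRing A] [IsNoetherianRing A] (P : Ideal (Polynomial A))
    (hP : P.IsMaximal) (_hc : (P.comap Polynomial.C).IsMaximal) :
    P.height = (P.comap Polynomial.C).height + 1 := by
  have hl : P.LiesOver (P.comap Polynomial.C) := ⟨rfl⟩
  exact Polynomial.height_eq_height_add_one (P.comap Polynomial.C) P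

theorem height_maximal_mvPoly (K : Type*) [Field K] (s : ℕ) :
    ∀ (M : Ideal (MvPolynomial (Fin s) K)), M.IsMaximal → M.height = s := by
  induction s with
  | zero =>
    intro M hM
    have h1 : M.height ≤ ringKrullDim (MvPolynomial (Fin 0) K) :=
      Ideal.height_le_ringKrullDim_of_ne_top hM.ne_top
    simp only [MvPolynomial.ringKrullDim_of_isNoetherianRing, ringKrullDim_eq_zero_of_field,
      Nat.card_eq_fintype_card, Fintype.card_fin, Nat.cast_zero, add_zero] at h1
    have h2 : M.height ≤ 0 := by exact_mod_cast h1
    simpa using h2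
  | succ s ih =>
    intro M hM
    let e := (MvPolynomial.finSuccEquiv K s).toRingEquiv
    have hP : (M.map e).IsMaximal := Ideal.map_isMaximal_of_equiv e
    have h1 : (M.map e).height = M.height := e.height_map M
    rw [← h1]
    generalize M.map e = P at hP
    have hc : (P.comap Polynomial.C).IsMaximal :=
      Polynomial.isMaximal_comap_C_of_isJacobsonRing P
    rw [height_poly_aux P hP hc, ih _ hc]
    push_cast; rfl

theorem height_maximal_domain (K D : Type*) [Field K] [CommRing D] [IsDomain D] [Algebra K D]
    [Algebra.FiniteType K D] : ∃ s : ℕ, ∀ x : Ideal D, x.IsMaximal → x.height = s := by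
  obtain ⟨s, g, hinj, hint⟩ := exists_integral_inj_algHom_of_fg K D
  refine ⟨s, fun x hx => ?_⟩
  algebraize [g.toRingHom]
  have : Algebra.IsIntegral (MvPolynomial (Fin s) K) D := ⟨hint⟩
  have : FaithfulSMul (MvPolynomial (Fin s) K) D :=
    (faithfulSMul_iff_algebraMap_injective _ _).2 hinj
  have : IsNoetherianRing D := Algebra.FiniteType.isNoetherianRing K D
  have hq : (x.under (MvPolynomial (Fin s) K)).IsMaximal :=
    Ideal.isMaximal_comap_of_isIntegral_of_isMaximal x
  have hqh := height_maximal_mvPoly K s _ hq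
  apply le_antisymm
  · have hmono : StrictMono (PrimeSpectrum.comap (algebraMap (MvPolynomial (Fin s) K) D)) := by
      intro p q hpq
      have := Ideal.comap_lt_comap_of_integral_mem_sdiff (R := MvPolynomial (Fin s) K)
        (I := p.asIdeal) (J := q.asIdeal) hpq.le (x := ?_) ?_ ?_
      · exact this
      · exact (SetLike.exists_of_lt ((PrimeSpectrum.asIdeal_lt_asIdeal p q).2 hpq)).choose
      · exact (SetLike.exists_of_lt ((PrimeSpectrum.asIdeal_lt_asIdeal p q).2 hpq)).choose_spec
      · exact Algebra.IsIntegral.isIntegral _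
    have := Order.height_le_height_apply_of_strictMono _ hmono ⟨x, hx.isPrime⟩
    rw [← PrimeSpectrum.height_eq_orderHeight, ← PrimeSpectrum.height_eq_orderHeight] at this
    refine this.trans ?_
    rw [← hqh]; rfl
  · rw [Ideal.height_eq_height_add_of_liesOver_of_hasGoingDown
      (x.under (MvPolynomial (Fin s) K)) x, hqh]
    exact le_self_add

theorem regList_of_forall {L : Type*} [CommRing L] (rs : List L) : ∀ Q : Ideal L,
    (∀ i (h : i < rs.length), RegOn (Q ⊔ Ideal.ofList (rs.take i)) rs[i]) → RegList Q rs := by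
  induction rs with
  | nil => intros; trivial
  | cons r rs ih =>
    intro Q h
    refine ⟨by
      have := h 0 (by simp)
      simp only [List.take_zero, Ideal.ofList_nil, sup_bot_eq] at this
      exact this, ih _ fun i hi => ?_⟩
    have := h (i + 1) (by simpa using hi)
    simpa [List.take_succ_cons, Ideal.ofList_cons, sup_assoc] using this

theorem regList_of_isWeaklyRegular {L : Type*} [CommRing L] (rs : List L)
    (h : RingTheory.Sequence.IsWeaklyRegular L rs) : RegList ⊥ rs := by
  apply regList_of_forall
  intro i hi z hz
  rw [bot_sup_eq] at hz ⊢
  have h1 := h.regular_mod_prev i hi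
  have h2 : (Ideal.ofList (rs.take i) • ⊤ : Ideal L) = Ideal.ofList (rs.take i) := by
    rw [smul_eq_mul, Ideal.mul_top]
  rw [isSMulRegular_iff_right_eq_zero_of_smul] at h1
  have h3 := h1 (Submodule.Quotient.mk z) (by
    rw [← Submodule.Quotient.mk_smul, Submodule.Quotient.mk_eq_zero, h2]
    exact hz)
  rwa [Submodule.Quotient.mk_eq_zero, h2] at h3

theorem dep_of_regList {L : Type*} [CommRing L] [IsLocalRing L] (rs : List L) :
    ∀ (Q : Ideal L) (k : ℕ), k ≤ rs.length → (∀ r ∈ rs, r ∈ IsLocalRing.maximalIdeal L) →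
      RegList Q rs → Dep k Q := by
  induction rs with
  | nil => intro Q k hk _ _; obtain rfl : k = 0 := by simpa using hk
           trivial
  | cons r rs ih =>
    intro Q k hk hm ⟨h1, h2⟩
    cases k with
    | zero => trivial
    | succ k => exact ⟨r, hm r (by simp), h1, ih _ k (by simpa using hk)
        (fun x hx => hm x (List.mem_cons_of_mem _ hx)) h2⟩

theorem dep_of_cm {A : Type*} [CommRing A] (hCM : cmdefLE A 0) (p : PrimeSpectrum A) (k : ℕ)
    (hk : (k : ℕ∞) ≤ p.asIdeal.height) :
    Dep k (⊥ : Ideal (Localization.AtPrime p.asIdeal)) := by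
  have h1 := hCM p
  rw [IsLocalization.AtPrime.ringKrullDim_eq_height p.asIdeal, add_zero] at h1
  have h2 : (k : ℕ∞) ≤ localDepth (Localization.AtPrime p.asIdeal) :=
    hk.trans (by exact_mod_cast h1)
  cases k with
  | zero => trivial
  | succ k =>
  have h3 : ∃ n ∈ {n : ℕ∞ | ∃ rs : List (Localization.AtPrime p.asIdeal), (rs.length : ℕ∞) = n ∧
    (∀ r ∈ rs, r ∈ IsLocalRing.maximalIdeal (Localization.AtPrime p.asIdeal)) ∧
      RingTheory.Sequence.IsRegular (Localization.AtPrime p.asIdeal) rs}, (k : ℕ∞) < n := by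
    rw [← lt_sSup_iff]
    refine lt_of_lt_of_le ?_ h2
    exact_mod_cast Nat.lt_succ_self k
  obtain ⟨_, ⟨rs, rfl, hm, hreg⟩, hlt⟩ := h3
  have h4 : k < rs.length := by exact_mod_cast hlt
  exact dep_of_regList rs ⊥ (k + 1) h4 hm (regList_of_isWeaklyRegular rs hreg.toIsWeaklyRegular)

theorem height_le_quot {A : Type*} [CommRing A] [IsNoetherianRing A] (hCM : cmdefLE A 0)
    (x p : Ideal A) [hx : x.IsPrime] (hp : p ∈ minimalPrimes A) (hpx : p ≤ x) :
    x.height ≤ (x.map (Ideal.Quotient.mk p)).height := by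
  have hpp : p.IsPrime := hp.1.1
  obtain ⟨k, hk⟩ : ∃ k : ℕ, x.height = k := ⟨x.height.toNat, by
    rw [ENat.natCast_toNat]; exact Ideal.height_ne_top_of_isPrime⟩
  let L := Localization.AtPrime x
  have hD : Dep k (⊥ : Ideal L) := dep_of_cm hCM ⟨x, hx⟩ k hk.ge
  have hdisj : Disjoint (x.primeCompl : Set A) (p : Set A) :=
    Set.disjoint_left.2 fun a ha hap => ha (hpx hap)
  let pL : Ideal L := p.map (algebraMap A L)
  have hpL : pL.IsPrime := IsLocalization.isPrime_of_isPrime_disjoint x.primeCompl L p hpp hdisj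
  have hcomap : pL.under A = p := IsLocalization.under_map_of_isPrime_disjoint x.primeCompl L hpp hdisj
  have hmin : pL ∈ minimalPrimes L := by
    refine ⟨⟨hpL, bot_le⟩, ?_⟩
    rintro q ⟨hq, _⟩ hle
    have h1 : q.comap (algebraMap A L) ≤ p := by
      rw [← hcomap]; exact Ideal.comap_mono hle
    have h2 : p ≤ q.comap (algebraMap A L) := hp.2 ⟨Ideal.comap_isPrime _ _, bot_le⟩ h1
    exact Ideal.map_le_iff_le_comap.2 h2
  have hass : pL ∈ associatedPrimes L (L ⧸ (⊥ : Ideal L)) := by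
    apply Module.associatedPrimes.minimalPrimes_annihilator_subset_associatedPrimes L (L ⧸ (⊥ : Ideal L))
    rw [Ideal.annihilator_quotient]
    exact hmin
  obtain ⟨l, hl, hlen⟩ := dep_chain k ⊥ ⟨pL, hpL⟩ hass hD
  have hmem : ∀ i, PrimeSpectrum.comap (algebraMap A L) (l i) ∈ PrimeSpectrum.zeroLocus (p : Set A) := by
    intro i
    have h1 : l.head ≤ l i := LTSeries.head_le l i
    rw [hl] at h1
    have h2 : pL.under A ≤ (l i).asIdeal.under A := Ideal.comap_mono h1
    rw [hcomap] at h2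
    exact h2
  have hmono : ∀ P Q : PrimeSpectrum L, P < Q →
      PrimeSpectrum.comap (algebraMap A L) P < PrimeSpectrum.comap (algebraMap A L) Q := by
    intro P Q hPQ
    refine lt_of_le_of_ne (Ideal.comap_mono hPQ.le) fun h => hPQ.ne ?_
    exact PrimeSpectrum.localization_comap_injective L x.primeCompl h
  let io := Ideal.primeSpectrumQuotientOrderIsoZeroLocus p
  let l' : LTSeries (PrimeSpectrum (A ⧸ p)) :=
    ⟨l.length, fun i => io.symm ⟨_, hmem i⟩, fun i => by
      apply io.symm.strictMono
      exact hmono _ _ (l.step i)⟩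
  have hxz : (⟨x, hx⟩ : PrimeSpectrum A) ∈ PrimeSpectrum.zeroLocus (p : Set A) := hpx
  have hlast : l'.last ≤ io.symm ⟨⟨x, hx⟩, hxz⟩ := by
    apply io.symm.monotone
    change (l.last).asIdeal.comap (algebraMap A L) ≤ x
    refine (Ideal.comap_mono (IsLocalRing.le_maximalIdeal_of_isPrime _)).trans_eq ?_
    exact Localization.AtPrime.under_maximalIdeal
  have h5 := Order.length_le_height hlast
  rw [← PrimeSpectrum.height_eq_orderHeight] at h5
  have h6 : l'.length = k := hlen
  rw [hk, ← h6]
  exact h5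

theorem equidim {K R : Type*} [Field K] [CommRing R] [Algebra K R]
    (hfg : Algebra.FiniteType K R)
    (hconn : IsConnected (Set.univ : Set (PrimeSpectrum R))) (hCM : cmdefLE R 0)
    (n : ℕ) (hn : ringKrullDim R = (n : WithBot ℕ∞)) (x : Ideal R) (hx : x.IsMaximal) :
    x.height = n := by
  have : IsNoetherianRing R := Algebra.FiniteType.isNoetherianRing K R
  have hs : ∀ p ∈ minimalPrimes R, ∃ s : ℕ, ∀ x : Ideal R, x.IsMaximal → p ≤ x → x.height = s := by
    intro p hp
    have hpp : p.IsPrime := hp.1.1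
    obtain ⟨s, hs⟩ := height_maximal_domain K (R ⧸ p)
    refine ⟨s, fun x hx hpx => ?_⟩
    have hxm : (x.map (Ideal.Quotient.mk p)).IsMaximal :=
      .map_of_surjective_of_ker_le Ideal.Quotient.mk_surjective (by rwa [Ideal.mk_ker])
    apply le_antisymm
    · rw [← hs _ hxm]
      exact height_le_quot hCM x p hp hpx
    · rw [← hs _ hxm]
      have h := Order.height_le_height_apply_of_strictMono
        (PrimeSpectrum.comap (Ideal.Quotient.mk p))
        (RingHom.strictMono_comap_of_surjective Ideal.Quotient.mk_surjective)
        ⟨x.map (Ideal.Quotient.mk p), hxm.isPrime⟩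
      rw [← PrimeSpectrum.height_eq_orderHeight, ← PrimeSpectrum.height_eq_orderHeight] at h
      refine h.trans (le_of_eq ?_)
      congr 1
      rw [PrimeSpectrum.comap_asIdeal]
      simp only
      rw [Ideal.comap_map_of_surjective _ Ideal.Quotient.mk_surjective, ← RingHom.ker_eq_comap_bot,
        Ideal.mk_ker, sup_eq_left.2 hpx]
  choose! s hs using hs
  have hfin : (minimalPrimes R).Finite := minimalPrimes.finite_of_isNoetherianRing R
  have hclosed : ∀ T ⊆ minimalPrimes R,
      IsClosed (⋃ p ∈ T, PrimeSpectrum.zeroLocus (p : Set R)) := fun T hT =>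
    (hfin.subset hT).isClosed_biUnion fun p _ => PrimeSpectrum.isClosed_zeroLocus _
  by_contra hne
  have h1 := isPreconnected_closed_iff.1 hconn.isPreconnected _ _
    (hclosed {p | p ∈ minimalPrimes R ∧ s p = n} fun p hp => hp.1)
    (hclosed {p | p ∈ minimalPrimes R ∧ s p ≠ n} fun p hp => hp.1) ?_ ?_ ?_
  · obtain ⟨q, _, hq1, hq2⟩ := h1
    simp only [Set.mem_iUnion] at hq1 hq2
    obtain ⟨p, ⟨hp, hpn⟩, hpq⟩ := hq1
    obtain ⟨p', ⟨hp', hpn'⟩, hpq'⟩ := hq2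
    obtain ⟨y, hy, hqy⟩ := Ideal.exists_le_maximal q.asIdeal q.2.ne_top
    have e1 := hs p hp y hy (le_trans hpq hqy)
    have e2 := hs p' hp' y hy (le_trans hpq' hqy)
    rw [e1] at e2
    apply hpn'
    rw [← hpn]; exact_mod_cast e2.symm
  · intro q _
    obtain ⟨p, hp, hpq⟩ := Ideal.exists_minimalPrimes_le (I := ⊥) (J := q.asIdeal) bot_le
    simp only [Set.mem_union, Set.mem_iUnion]
    by_cases h : s p = n
    · exact Or.inl ⟨p, ⟨hp, h⟩, hpq⟩
    · exact Or.inr ⟨p, ⟨hp, h⟩, hpq⟩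
  · have : FiniteRingKrullDim R := finiteRingKrullDim_iff_ne_bot_and_top.2 (by
      rw [hn]; exact ⟨by simp, WithBot.coe_injective.ne (ENat.natCast_ne_top n)⟩)
    obtain ⟨y, hy, hyh⟩ := Ideal.exists_isMaximal_height (R := R)
    rw [hn] at hyh
    have hyh' : y.height = n := by exact_mod_cast hyh
    have hyp := hy.isPrime
    obtain ⟨p, hp, hpy⟩ := Ideal.exists_minimalPrimes_le (I := ⊥) (J := y) bot_le
    refine ⟨⟨y, hyp⟩, trivial, ?_⟩
    simp only [Set.mem_iUnion]
    refine ⟨p, ⟨hp, ?_⟩, hpy⟩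
    have := hs p hp y hy hpy
    rw [hyh'] at this
    exact_mod_cast this.symm
  · have hxp := hx.isPrime
    obtain ⟨p, hp, hpx⟩ := Ideal.exists_minimalPrimes_le (I := ⊥) (J := x) bot_le
    refine ⟨⟨x, hxp⟩, trivial, ?_⟩
    simp only [Set.mem_iUnion]
    refine ⟨p, ⟨hp, fun h => hne ?_⟩, hpx⟩
    rw [hs p hp x hx hpx, h]

/-! ### Part 4: points -/

theorem point_of_maximal {K B : Type*} [Field K] [IsAlgClosed K] [CommRing B] [Algebra K B]
    [Algebra.FiniteType K B] (M : Ideal B) (hM : M.IsMaximal) :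
    ∃ y : B →ₐ[K] K, RingHom.ker y = M := by
  let _ : Field (B ⧸ M) := Ideal.Quotient.field M
  have hft : Algebra.FiniteType K (B ⧸ M) := inferInstance
  have hf : Module.Finite K (B ⧸ M) := finite_of_finite_type_of_isJacobsonRing K (B ⧸ M)
  have ha : Algebra.IsAlgebraic K (B ⧸ M) := Algebra.IsAlgebraic.of_finite K (B ⧸ M)
  let l : (B ⧸ M) →ₐ[K] K := IsAlgClosed.lift
  refine ⟨l.comp (Ideal.Quotient.mkₐ K M), ?_⟩
  ext b
  have : l (Ideal.Quotient.mk M b) = 0 ↔ Ideal.Quotient.mk M b = 0 :=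
    map_eq_zero_iff l l.toRingHom.injective
  rw [Ideal.Quotient.eq_zero_iff_mem] at this
  exact this

theorem eq_of_ker_le {K B : Type*} [Field K] [CommRing B] [Algebra K B] (y z : B →ₐ[K] K)
    (h : ∀ f, y f = 0 → z f = 0) : y = z := by
  ext f
  have := h (f - algebraMap K B (y f)) (by simp)
  simp only [map_sub, AlgHom.commutes, Algebra.algebraMap_self, RingHom.id_apply] at this
  exact (sub_eq_zero.1 this).symm

theorem ker_maximal {K B : Type*} [Field K] [CommRing B] [Algebra K B] (y : B →ₐ[K] K) :
    (RingHom.ker y).IsMaximal :=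
  RingHom.ker_isMaximal_of_surjective y fun c => ⟨algebraMap K B c, by simp⟩

theorem exists_orbit {K R G : Type*} [Field K] [CommRing R] [Algebra K R] [Group G] [Finite G]
    (φ : G →* (R ≃ₐ[K] R)) (y z : R →ₐ[K] K)
    (h : ∀ f ∈ invariantsAlg K R G φ, y f = z f) : ∃ σ : G, ∀ f, y f = z (φ σ f) := by
  cases nonempty_fintype G
  have h1 : ((RingHom.ker y : Ideal R) : Set R) ⊆ ⋃ σ ∈ ((Finset.univ : Finset G) : Set G),
      ((RingHom.ker (z.comp (φ σ).toAlgHom) : Ideal R) : Set R) := by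
    intro f hf
    have hN : ∏ σ : G, φ σ f ∈ invariantsAlg K R G φ := by
      intro τ
      rw [map_prod]
      refine Fintype.prod_equiv (Equiv.mulLeft τ) _ _ fun σ => ?_
      simp
    have h2 : y (∏ σ : G, φ σ f) = 0 := by
      rw [map_prod]
      refine Finset.prod_eq_zero (Finset.mem_univ 1) ?_
      rw [map_one]; exact hf
    rw [h _ hN, map_prod, Finset.prod_eq_zero_iff] at h2
    obtain ⟨σ, _, hσ⟩ := h2
    simp only [Set.mem_iUnion]
    exact ⟨σ, by simp, hσ⟩
  rw [Ideal.subset_union_prime 1 1 (fun σ _ _ _ => RingHom.ker_isPrime _)] at h1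
  obtain ⟨σ, _, hσ⟩ := h1
  refine ⟨σ, fun f => ?_⟩
  have := eq_of_ker_le y (z.comp (φ σ).toAlgHom) fun f hf => hσ hf
  exact DFunLike.congr_fun this f

theorem exists_sep {K R G : Type*} [Field K] [CommRing R] [Algebra K R] [Group G]
    (φ : G →* (R ≃ₐ[K] R)) (n : ℕ) (hsep : gammaSep K R G φ = (n : ℕ∞)) :
    ∃ fs : List R, fs.length = n ∧ (∀ f ∈ fs, f ∈ invariantsAlg K R G φ) ∧
      ∀ x y : R →ₐ[K] K, (∀ f ∈ fs, x f = y f) → ∀ f ∈ invariantsAlg K R G φ, x f = y f := by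
  have h1 : ∃ S, IsSeparating K R G φ S ∧ S.encard = n := by
    rw [gammaSep, iInf_subtype'] at hsep
    have : Nonempty {S : Set R // S ∈ {S : Set R | IsSeparating K R G φ S}} := by
      by_contra hne
      rw [not_nonempty_iff] at hne
      rw [iInf_of_empty] at hsep
      exact ENat.natCast_ne_top n hsep.symm
    obtain ⟨S, hS⟩ := ENat.exists_eq_iInf
      (fun S : {S : Set R // S ∈ {S : Set R | IsSeparating K R G φ S}} => S.1.encard)
    exact ⟨S.1, S.2, hS.trans hsep⟩
  obtain ⟨S, ⟨hS1, hS2⟩, hc⟩ := h1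
  have hfin : S.Finite := Set.finite_of_encard_eq_coe hc
  refine ⟨hfin.toFinset.toList, ?_, ?_, ?_⟩
  · rw [Finset.length_toList]
    rw [hfin.encard_eq_coe_toFinset_card] at hc
    exact_mod_cast hc
  · intro f hf
    exact hS1 (by simpa using hf)
  · intro x y hxy f hf
    by_contra hne
    obtain ⟨g, hg, hgne⟩ := hS2 x y ⟨f, hf, hne⟩
    exact hgne (hxy g (by simpa using hg))

/-! ### Part 5: flatness -/

theorem finite_fibre {K R G : Type*} [Field K] [IsAlgClosed K] [CommRing R] [Algebra K R]
    [Algebra.FiniteType K R] [Group G] [Finite G]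
    (φ : G →* (R ≃ₐ[K] R)) (fs : List R)
    (hfs : ∀ x y : R →ₐ[K] K, (∀ f ∈ fs, x f = y f) → ∀ f ∈ invariantsAlg K R G φ, x f = y f)
    (x : R →ₐ[K] K) (q : Ideal R) (hq : q.IsPrime) (hqx : q ≤ RingHom.ker x)
    (hfq : ∀ f ∈ fs, f - algebraMap K R (x f) ∈ q) : q = RingHom.ker x := by
  cases nonempty_fintype G
  have hJ : IsJacobsonRing R := isJacobsonRing_of_finiteType (A := K)
  have h1 : (Finset.univ : Finset G).inf
      (fun σ => (RingHom.ker (x.comp (φ σ).toAlgHom) : Ideal R)) ≤ q := by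
    have h2 : q.jacobson = q := by
      rw [← Ideal.radical_eq_jacobson, hq.radical]
    conv_rhs => rw [← h2]
    refine le_sInf ?_
    rintro M ⟨hqM, hM⟩
    obtain ⟨y, rfl⟩ := point_of_maximal (K := K) M hM
    obtain ⟨σ, hσ⟩ := exists_orbit φ y x (hfs y x fun f hf => by
      have := hqM (hfq f hf)
      simp only [RingHom.mem_ker, map_sub, AlgHom.commutes, Algebra.algebraMap_self,
        RingHom.id_apply] at this
      exact sub_eq_zero.1 this)
    refine (Finset.inf_le (Finset.mem_univ σ)).trans ?_
    intro f hf
    rw [RingHom.mem_ker, hσ f]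
    exact hf
  obtain ⟨σ, _, hσ⟩ := (Ideal.IsPrime.inf_le' hq).1 h1
  have hmax : (RingHom.ker (x.comp (φ σ).toAlgHom) : Ideal R).IsMaximal := ker_maximal _
  have e1 := hmax.eq_of_le hq.ne_top hσ
  have hmq : q.IsMaximal := e1 ▸ hmax
  exact hmq.eq_of_le (ker_maximal x).ne_top hqx

theorem regList_fibre {K R G : Type*} [Field K] [IsAlgClosed K] [CommRing R] [Algebra K R]
    [Algebra.FiniteType K R] [Group G] [Finite G]
    (φ : G →* (R ≃ₐ[K] R)) (fs : List R)
    (hfs : ∀ x y : R →ₐ[K] K, (∀ f ∈ fs, x f = y f) → ∀ f ∈ invariantsAlg K R G φ, x f = y f)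
    (x : R →ₐ[K] K) (m : Ideal R) [hmp : m.IsPrime] (hm : m = RingHom.ker x)
    (hCM : cmdefLE R 0) (hht : m.height = fs.length) :
    RegList (⊥ : Ideal (Localization.AtPrime m))
      (fs.map fun f => algebraMap R (Localization.AtPrime m) (f - algebraMap K R (x f))) := by
  have : IsNoetherianRing R := Algebra.FiniteType.isNoetherianRing K R
  have : IsNoetherianRing (Localization.AtPrime m) :=
    IsLocalization.isNoetherianRing m.primeCompl _ inferInstance
  have hmem : ∀ f ∈ fs, f - algebraMap K R (x f) ∈ m := by
    intro f _
    rw [hm, RingHom.mem_ker]; simp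
  apply dep_sop
  · rw [List.length_map]
    exact dep_of_cm hCM ⟨m, hmp⟩ _ hht.ge
  · intro g hg
    obtain ⟨f, hf, rfl⟩ := List.mem_map.1 hg
    rw [IsLocalization.AtPrime.to_map_mem_maximal_iff _ m]
    exact hmem f hf
  · intro q hq _ hfq
    have hle := IsLocalRing.le_maximalIdeal_of_isPrime q
    have h1 : q.comap (algebraMap R (Localization.AtPrime m)) ≤ m := by
      refine (Ideal.comap_mono hle).trans_eq ?_
      exact Localization.AtPrime.under_maximalIdeal
    have h2 := finite_fibre φ fs hfs x (q.comap (algebraMap R (Localization.AtPrime m)))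
      (Ideal.comap_isPrime _ _) (h1.trans_eq hm) fun f hf => hfq _ (List.mem_map.2 ⟨f, hf, rfl⟩)
    apply le_antisymm hle
    rw [← Localization.AtPrime.map_eq_maximalIdeal, Ideal.map_le_iff_le_comap, h2, hm]

theorem regList_comap {D L : Type*} [CommRing D] [CommRing L] (θ : D →+* L)
    (hθ : Function.Surjective θ) (gs : List D) : ∀ Q : Ideal L,
    RegList Q (gs.map θ) → RegList (Q.comap θ) gs := by
  induction gs with
  | nil => intros; trivial
  | cons g gs ih =>
    rintro Q ⟨h1, h2⟩
    refine ⟨fun z hz => h1 (θ z) (by rw [← map_mul]; exact hz), ?_⟩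
    have h3 := ih _ h2
    have : (Q ⊔ Ideal.span {θ g}).comap θ = Q.comap θ ⊔ Ideal.span {g} := by
      ext v
      rw [Ideal.mem_comap, mem_sup_span, mem_sup_span]
      constructor
      · rintro ⟨q, hq, t, ht⟩
        obtain ⟨t, rfl⟩ := hθ t
        refine ⟨v - g * t, ?_, t, by ring⟩
        rw [Ideal.mem_comap, map_sub, map_mul, ht]; simpa using hq
      · rintro ⟨q, hq, t, rfl⟩
        exact ⟨θ q, hq, θ t, by simp⟩
    rwa [this] at h3

/-- evaluation of the left factor at `x` -/
def thetaMap {K R : Type*} [Field K] [CommRing R] [Algebra K R] (x : R →ₐ[K] K) :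
    R ⊗[K] R →ₐ[K] R :=
  Algebra.TensorProduct.productMap ((Algebra.ofId K R).comp x) (AlgHom.id K R)

theorem thetaMap_tmul {K R : Type*} [Field K] [CommRing R] [Algebra K R] (x : R →ₐ[K] K)
    (u v : R) : thetaMap x (u ⊗ₜ v) = algebraMap K R (x u) * v := by
  simp [thetaMap, Algebra.ofId_apply]

theorem theta_ker {K R : Type*} [Field K] [CommRing R] [Algebra K R] (x : R →ₐ[K] K)
    (a : R ⊗[K] R) : a - 1 ⊗ₜ thetaMap x a ∈
      (RingHom.ker x : Ideal R).map (algebraMap R (R ⊗[K] R)) := by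
  induction a using TensorProduct.induction_on with
  | zero => simp
  | tmul u v =>
    rw [thetaMap_tmul]
    have h : (u ⊗ₜ[K] v - 1 ⊗ₜ[K] (algebraMap K R (x u) * v) : R ⊗[K] R) =
        algebraMap R (R ⊗[K] R) (u - algebraMap K R (x u)) * (1 ⊗ₜ[K] v) := by
      rw [Algebra.TensorProduct.algebraMap_apply, Algebra.TensorProduct.tmul_mul_tmul]
      simp only [Algebra.algebraMap_self, RingHom.id_apply, mul_one, one_mul, sub_tmul]
      rw [← Algebra.smul_def, Algebra.algebraMap_eq_smul_one, tmul_smul, smul_tmul']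
    rw [h]
    refine Ideal.mul_mem_right _ _ (Ideal.mem_map_of_mem _ ?_)
    rw [RingHom.mem_ker]; simp
  | add a b ha hb =>
    rw [map_add, tmul_add, add_sub_add_comm]
    exact add_mem ha hb

theorem regList_D {K R : Type*} [Field K] [CommRing R] [Algebra K R]
    (x : R →ₐ[K] K) (m : Ideal R) [hmp : m.IsPrime] (hm : m = RingHom.ker x)
    (P : Ideal (R ⊗[K] R)) [P.IsPrime] (hP : P = m.comap (thetaMap x).toRingHom) (fs : List R)
    (h : RegList (⊥ : Ideal (Localization.AtPrime m))
      (fs.map fun f => algebraMap R (Localization.AtPrime m) (f - algebraMap K R (x f)))) :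
    RegList (m.map (algebraMap R (Localization.AtPrime P)))
      (fs.map fun f => algebraMap (R ⊗[K] R) (Localization.AtPrime P)
        ((1 : R) ⊗ₜ[K] f - f ⊗ₜ[K] (1 : R))) := by
  let T := Localization.localRingHom P m (thetaMap x).toRingHom hP
  have hθs : Function.Surjective (thetaMap x) := fun r => ⟨1 ⊗ₜ r, by simp [thetaMap_tmul]⟩
  have hT : Function.Surjective T := by
    intro l
    obtain ⟨a, s, rfl⟩ := IsLocalization.exists_mk'_eq m.primeCompl l
    obtain ⟨a, rfl⟩ := hθs a
    obtain ⟨s, hs⟩ := s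
    obtain ⟨s, rfl⟩ := hθs s
    refine ⟨IsLocalization.mk' _ a (⟨s, fun h => hs ?_⟩ : P.primeCompl), ?_⟩
    · rw [hP] at h; exact h
    · exact Localization.localRingHom_mk' P m _ hP a _
  have hker : (⊥ : Ideal (Localization.AtPrime m)).comap T =
      m.map (algebraMap R (Localization.AtPrime P)) := by
    rw [IsScalarTower.algebraMap_eq R (R ⊗[K] R) (Localization.AtPrime P), ← Ideal.map_map]
    apply le_antisymm
    · intro d hd
      obtain ⟨a, s, rfl⟩ := IsLocalization.exists_mk'_eq P.primeCompl d
      rw [Ideal.mem_comap, Localization.localRingHom_mk', Ideal.mem_bot,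
        IsLocalization.mk'_eq_zero_iff] at hd
      obtain ⟨⟨t, ht⟩, hta⟩ := hd
      have h1 : (1 ⊗ₜ[K] t * a : R ⊗[K] R) ∈ m.map (algebraMap R (R ⊗[K] R)) := by
        have h2 := theta_ker x (1 ⊗ₜ[K] t * a)
        have h3 : thetaMap x (1 ⊗ₜ[K] t * a) = 0 := by
          rw [map_mul, thetaMap_tmul]
          simpa using hta
        rw [h3, tmul_zero, sub_zero] at h2
        rwa [hm]
      have h4 : (1 ⊗ₜ[K] t : R ⊗[K] R) ∈ P.primeCompl := by
        intro h
        rw [hP] at h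
        apply ht
        have h5 : thetaMap x (1 ⊗ₜ[K] t) ∈ m := h
        simpa [thetaMap_tmul] using h5
      rw [IsLocalization.mk'_mem_map_algebraMap_iff P.primeCompl]
      exact ⟨_, h4, h1⟩
    · rw [Ideal.map_le_iff_le_comap, Ideal.map_le_iff_le_comap]
      intro u hu
      simp only [Ideal.mem_comap, Ideal.mem_bot]
      rw [Localization.localRingHom_to_map]
      have : (thetaMap x).toRingHom (algebraMap R (R ⊗[K] R) u) = 0 := by
        change thetaMap x (u ⊗ₜ 1) = 0
        rw [hm, RingHom.mem_ker] at hu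
        rw [thetaMap_tmul, hu]; simp
      rw [this, map_zero]
  rw [← hker]
  apply regList_comap T hT
  rw [List.map_map]
  convert h using 3 with f
  simp only [Function.comp_apply]
  rw [Localization.localRingHom_to_map]
  congr 1
  change thetaMap x _ = _
  rw [map_sub, thetaMap_tmul, thetaMap_tmul]; simp

theorem finiteType_tensor (K R : Type*) [Field K] [CommRing R] [Algebra K R]
    [h : Algebra.FiniteType K R] : Algebra.FiniteType K (R ⊗[K] R) :=
  Algebra.FiniteType.trans (S := R) h (Algebra.FiniteType.baseChange R)

theorem flat_S {K R G : Type*} [Field K] [IsAlgClosed K] [CommRing R] [Algebra K R]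
    [Algebra.FiniteType K R] [Group G] [Finite G]
    (φ : G →* (R ≃ₐ[K] R)) (fs : List R)
    (hfs : ∀ x y : R →ₐ[K] K, (∀ f ∈ fs, x f = y f) → ∀ f ∈ invariantsAlg K R G φ, x f = y f)
    (x : R →ₐ[K] K) (m : Ideal R) [hmp : m.IsPrime] (hm : m = RingHom.ker x)
    (P : Ideal (R ⊗[K] R)) [hPp : P.IsPrime] (hP : P = m.comap (thetaMap x).toRingHom)
    (hCM : cmdefLE R 0) (hht : m.height = fs.length) :
    Module.Flat R (Localization.AtPrime P ⧸ (⊥ ⊔ Ideal.span {g | g ∈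
      (fs.map fun f => algebraMap (R ⊗[K] R) (Localization.AtPrime P)
        ((1 : R) ⊗ₜ[K] f - f ⊗ₜ[K] (1 : R)))})) := by
  have hNR : IsNoetherianRing R := Algebra.FiniteType.isNoetherianRing K R
  have : Algebra.FiniteType K (R ⊗[K] R) := finiteType_tensor K R
  have : IsNoetherianRing (R ⊗[K] R) := Algebra.FiniteType.isNoetherianRing K _
  have : IsNoetherianRing (Localization.AtPrime P) :=
    IsLocalization.isNoetherianRing P.primeCompl _ inferInstance
  have : m.IsMaximal := hm ▸ ker_maximal x
  have f1 : Module.Flat (R ⊗[K] R) (Localization.AtPrime P) :=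
    IsLocalization.flat _ P.primeCompl
  have f2 : Module.Flat R (Localization.AtPrime P) := Module.Flat.trans R (R ⊗[K] R) _
  have f3 : Module.Flat R (Localization.AtPrime P ⧸ (⊥ : Ideal (Localization.AtPrime P))) :=
    Module.Flat.of_linearEquiv
      ((Submodule.quotEquivOfEqBot (⊥ : Ideal (Localization.AtPrime P)) rfl).restrictScalars R)
  apply flat_list (m := m)
  · rw [IsScalarTower.algebraMap_eq R (R ⊗[K] R) (Localization.AtPrime P), ← Ideal.map_map,
      ← Localization.AtPrime.map_eq_maximalIdeal]
    apply Ideal.map_mono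
    rw [Ideal.map_le_iff_le_comap]
    intro u hu
    rw [hP]
    change thetaMap x (u ⊗ₜ 1) ∈ m
    have : x u = 0 := by rw [hm] at hu; exact hu
    rw [thetaMap_tmul, this]; simp
  · exact bot_le
  · intro g hg
    obtain ⟨f, hf, rfl⟩ := List.mem_map.1 hg
    rw [IsLocalization.AtPrime.to_map_mem_maximal_iff _ P, hP]
    change thetaMap x _ ∈ m
    rw [map_sub, thetaMap_tmul, thetaMap_tmul, hm, RingHom.mem_ker]; simp
  · exact f3
  · rw [bot_sup_eq]
    exact regList_D x m hm P hP fs (regList_fibre φ fs hfs x m hm hCM hht)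

/-! ### Part 6: ideals of graphs -/

/-- pullback to the graph of `σ` -/
def mMap {K R G : Type*} [Field K] [CommRing R] [Algebra K R] [Group G]
    (φ : G →* (R ≃ₐ[K] R)) (σ : G) : R ⊗[K] R →ₐ[K] R :=
  Algebra.TensorProduct.productMap (AlgHom.id K R) (φ σ).toAlgHom

theorem mMap_tmul {K R G : Type*} [Field K] [CommRing R] [Algebra K R] [Group G]
    (φ : G →* (R ≃ₐ[K] R)) (σ : G) (u v : R) : mMap φ σ (u ⊗ₜ v) = u * φ σ v := by
  simp [mMap]

/-- ideal of the union of graphs of elements of `T` -/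
def graphIdeal {K R G : Type*} [Field K] [CommRing R] [Algebra K R] [Group G]
    (φ : G →* (R ≃ₐ[K] R)) (T : Finset G) : Ideal (R ⊗[K] R) :=
  T.inf fun σ => (RingHom.ker (mMap φ σ) : Ideal (R ⊗[K] R))

theorem graphIdeal_le_radical {K R G : Type*} [Field K] [IsAlgClosed K] [CommRing R] [Algebra K R]
    [Algebra.FiniteType K R] [Group G] [Fintype G]
    (φ : G →* (R ≃ₐ[K] R)) (fs : List R)
    (hfs : ∀ x y : R →ₐ[K] K, (∀ f ∈ fs, x f = y f) → ∀ f ∈ invariantsAlg K R G φ, x f = y f)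
    (I : Ideal (R ⊗[K] R)) (hI : ∀ f ∈ fs, ((1 : R) ⊗ₜ[K] f - f ⊗ₜ[K] (1 : R)) ∈ I) :
    graphIdeal φ Finset.univ ≤ I.radical := by
  have hft : Algebra.FiniteType K (R ⊗[K] R) := finiteType_tensor K R
  have hJ : IsJacobsonRing (R ⊗[K] R) := isJacobsonRing_of_finiteType (A := K)
  rw [Ideal.radical_eq_jacobson]
  refine le_sInf ?_
  rintro M ⟨hIM, hM⟩
  obtain ⟨w, rfl⟩ := point_of_maximal (K := K) M hM
  obtain ⟨σ, hσ⟩ := exists_orbit φ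
    (w.comp Algebra.TensorProduct.includeRight) (w.comp Algebra.TensorProduct.includeLeft)
    (hfs _ _ fun f hf => by
      have := hIM (hI f hf)
      rw [RingHom.mem_ker, map_sub] at this
      exact sub_eq_zero.1 this)
  refine (Finset.inf_le (Finset.mem_univ σ)).trans ?_
  have hw : w = (w.comp Algebra.TensorProduct.includeLeft).comp (mMap φ σ) := by
    apply Algebra.TensorProduct.ext'
    intro u v
    have h1 : (u ⊗ₜ[K] v : R ⊗[K] R) = u ⊗ₜ 1 * 1 ⊗ₜ v := by simp
    have h2 := hσ v
    simp only [AlgHom.comp_apply, Algebra.TensorProduct.includeRight_apply,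
      Algebra.TensorProduct.includeLeft_apply] at h2 ⊢
    rw [mMap_tmul, h1, map_mul, h2, ← map_mul, Algebra.TensorProduct.tmul_mul_tmul, one_mul]
  intro a ha
  rw [RingHom.mem_ker] at ha ⊢
  rw [hw, AlgHom.comp_apply, ha, map_zero]

theorem exists_refl_of_le {K R G : Type*} [Field K] [CommRing R] [Algebra K R]
    [Group G] [Fintype G] [DecidableEq G] (φ : G →* (R ≃ₐ[K] R)) (H : Subgroup G) (T1 T2 : Finset G)
    (hT1 : ∀ σ ∈ T1, σ ∈ H) (hT2 : ∀ σ, σ ∈ T2 ↔ σ ∉ H) (N : ℕ)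
    (q : Ideal R) (hq : q.IsPrime)
    (hle : (graphIdeal φ T1 ^ N ⊔ graphIdeal φ T2 ^ N).comap (algebraMap R (R ⊗[K] R)) ≤ q) :
    ∃ τ, τ ∉ H ∧ reflIdeal K R G φ τ ≤ q := by
  have h1 : T2.inf (fun τ => reflIdeal K R G φ τ) ≤ q := by
    refine le_trans ?_ (hq.radical_le_iff.2 hle)
    rw [← Ideal.comap_radical, ← Ideal.map_le_iff_le_comap, Ideal.radical_eq_sInf]
    refine le_sInf ?_
    rintro Q ⟨hJQ, hQ⟩
    obtain ⟨σ, hσ, hσQ⟩ := (Ideal.IsPrime.inf_le' hQ).1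
      (hQ.le_of_pow_le (le_sup_left.trans hJQ))
    obtain ⟨τ, hτ, hτQ⟩ := (Ideal.IsPrime.inf_le' hQ).1
      (hQ.le_of_pow_le (le_sup_right.trans hJQ))
    have hm : σ * τ⁻¹ ∈ T2 := by
      rw [hT2]
      intro h
      apply (hT2 τ).1 hτ
      have := H.mul_mem (H.inv_mem h) (hT1 σ hσ)
      simpa using this
    rw [Ideal.map_le_iff_le_comap]
    refine (Finset.inf_le hm).trans ?_
    rw [reflIdeal, Ideal.span_le]
    rintro _ ⟨w, rfl⟩
    have e1 : ∀ ρ : G, (φ ρ (φ τ⁻¹ w) ⊗ₜ[K] (1 : R) - (1 : R) ⊗ₜ[K] (φ τ⁻¹ w)) ∈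
        (RingHom.ker (mMap φ ρ) : Ideal (R ⊗[K] R)) := by
      intro ρ
      rw [RingHom.mem_ker, map_sub, mMap_tmul, mMap_tmul]; simp
    have e2 := Q.sub_mem (hσQ (e1 σ)) (hτQ (e1 τ))
    change (φ (σ * τ⁻¹) w - w) ⊗ₜ[K] (1 : R) ∈ Q
    rw [sub_sub_sub_cancel_right, ← sub_tmul, ← AlgEquiv.mul_apply, ← AlgEquiv.mul_apply,
      ← map_mul, ← map_mul] at e2
    simpa using e2
  obtain ⟨τ, hτ, h⟩ := (Ideal.IsPrime.inf_le' hq).1 h1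
  exact ⟨τ, (hT2 τ).1 hτ, h⟩

theorem two_le_height {K R G : Type*} [Field K] [CommRing R] [Algebra K R] [Group G]
    (φ : G →* (R ≃ₐ[K] R)) (τ : G) (hτ : ¬ IsKReflection K R G φ 1 τ) (q : Ideal R)
    (hq : q.IsPrime) (h : reflIdeal K R G φ τ ≤ q) : 2 ≤ q.height := by
  rw [IsKReflection, codimIn, not_le] at hτ
  have h1 := hτ.trans_le (iInf_le _ ⟨⟨⟨q, hq⟩, trivial⟩, h⟩)
  have h2 := Order.height_orderIso OrderIso.Set.univ
    (⟨⟨q, hq⟩, trivial⟩ : (Set.univ : Set (PrimeSpectrum R)))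
  rw [← h2] at h1
  change 1 < Order.height (⟨q, hq⟩ : PrimeSpectrum R) at h1
  rw [← PrimeSpectrum.height_eq_orderHeight] at h1
  have := Order.add_one_le_of_lt h1
  rwa [one_add_one_eq_two] at this

theorem loc_colon {R : Type*} [CommRing R] (Q p : Ideal R) [p.IsPrime] (w : R)
    (hp : ∀ r, r ∈ p ↔ r * w ∈ Q) :
    algebraMap R (Localization.AtPrime p) w ∉ Q.map (algebraMap R (Localization.AtPrime p)) ∧
    ∀ r ∈ IsLocalRing.maximalIdeal (Localization.AtPrime p),
      r * algebraMap R (Localization.AtPrime p) w ∈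
        Q.map (algebraMap R (Localization.AtPrime p)) := by
  constructor
  · intro h
    rw [IsLocalization.algebraMap_mem_map_algebraMap_iff p.primeCompl] at h
    obtain ⟨s, hs, h⟩ := h
    exact hs ((hp s).2 h)
  · intro r hr
    obtain ⟨a, s, rfl⟩ := IsLocalization.exists_mk'_eq p.primeCompl r
    rw [IsLocalization.AtPrime.mk'_mem_maximal_iff _ p] at hr
    rw [mul_comm, IsLocalization.mul_mk'_eq_mk'_of_mul,
      IsLocalization.mk'_mem_map_algebraMap_iff p.primeCompl]
    exact ⟨1, p.primeCompl.one_mem, by rw [one_mul, mul_comm]; exact (hp a).1 hr⟩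

theorem regOn_loc {R : Type*} [CommRing R] (p : Ideal R) [p.IsPrime] (a : R)
    (ha : RegOn ⊥ a) : RegOn ⊥ (algebraMap R (Localization.AtPrime p) a) := by
  intro z hz
  obtain ⟨c, s, rfl⟩ := IsLocalization.exists_mk'_eq p.primeCompl z
  rw [Ideal.mem_bot, ← IsLocalization.mk'_one (M := p.primeCompl), ← IsLocalization.mk'_mul,
    IsLocalization.mk'_eq_zero_iff] at hz
  obtain ⟨t, ht⟩ := hz
  rw [Ideal.mem_bot, IsLocalization.mk'_eq_zero_iff]
  exact ⟨t, ha _ (by rw [Ideal.mem_bot, ← ht]; ring)⟩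

theorem exists_reg_pair {R : Type*} [CommRing R] [IsNoetherianRing R] (hCM : cmdefLE R 0)
    (j : Ideal R) (hj : ∀ q : Ideal R, q.IsPrime → j ≤ q → 2 ≤ q.height) :
    ∃ a ∈ j, ∃ b ∈ j, RegOn ⊥ a ∧ RegOn (Ideal.span {a}) b := by
  have hD : ∀ (p : Ideal R) [hp : p.IsPrime], j ≤ p →
      Dep 2 (⊥ : Ideal (Localization.AtPrime p)) := fun p hp h =>
    dep_of_cm hCM ⟨p, hp⟩ 2 (hj p hp h)
  have h1 : ∀ p ∈ associatedPrimes R (R ⧸ (⊥ : Ideal R)), ¬ j ≤ p := by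
    intro p hp hjp
    obtain ⟨hpp, w, hw, hc⟩ := assoc_colon hp
    obtain ⟨h2, h3⟩ := loc_colon ⊥ p w hc
    obtain ⟨y, hy, hreg, _⟩ := hD p hjp
    rw [Ideal.map_bot] at h2 h3
    exact h2 (hreg _ (h3 y hy))
  obtain ⟨a, haj, ha, _⟩ := exists_regOn_of h1 h1
  have h4 : ∀ p ∈ associatedPrimes R (R ⧸ (Ideal.span {a} : Ideal R)), ¬ j ≤ p := by
    intro p hp hjp
    obtain ⟨hpp, w, hw, hc⟩ := assoc_colon hp
    obtain ⟨h2, h3⟩ := loc_colon _ p w hc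
    obtain ⟨y, hy, hreg, z, hz, hreg2, _⟩ := hD p hjp
    rw [Ideal.map_span, Set.image_singleton] at h2 h3
    obtain ⟨r, hr, hrw⟩ := exchange_one hy hz hreg hreg2 (regOn_loc p a ha)
      _ (by rw [bot_sup_eq]; exact h2)
    rw [bot_sup_eq] at hrw
    exact hrw (h3 r hr)
  obtain ⟨b, hbj, hb, _⟩ := exists_regOn_of h4 h4
  exact ⟨a, haj, b, hbj, ha, hb⟩

/-! ### Part 7: conclusion -/

theorem final_step {R S L : Type*} [CommRing R] [CommRing S] [CommRing L] [Algebra R S]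
    [Nontrivial L] [Module.Flat R S] [IsLocalRing S] (a b : R)
    (hb : RegOn (Ideal.span {a}) b) (a1 a2 b1 b2 : S)
    (ha12 : a1 + a2 = algebraMap R S a) (hb12 : b1 + b2 = algebraMap R S b)
    (h12 : a1 * b2 = 0) (h21 : b1 * a2 = 0) (ψ χ : S →+* L)
    (hψ : RegOn ⊥ (ψ (algebraMap R S a))) (hχ : RegOn ⊥ (χ (algebraMap R S a)))
    (h1 : ψ a1 = 0) (h2 : χ a2 = 0) : False := by
  have h3 : a2 ∈ (Ideal.span {a}).map (algebraMap R S) := by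
    refine flat_colon (u := b) (I := Ideal.span {a}) hb ?_
    have : b • a2 = algebraMap R S a * b2 := by
      rw [Algebra.smul_def, ← hb12, ← ha12, add_mul, add_mul, h12, h21]; ring
    rw [this]
    exact Ideal.mul_mem_right _ _ (Ideal.mem_map_of_mem _ (Ideal.mem_span_singleton_self a))
  rw [Ideal.map_span, Set.image_singleton, Ideal.mem_span_singleton] at h3
  obtain ⟨e, he⟩ := h3
  have e1 : ψ e - 1 ∈ (⊥ : Ideal L) := by
    apply hψ
    rw [Ideal.mem_bot, mul_sub, mul_one, ← map_mul, ← he, ← ha12, map_add, h1]; ring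
  have e2 : χ e ∈ (⊥ : Ideal L) := by
    apply hχ
    rw [Ideal.mem_bot, ← map_mul, ← he, h2]
  rw [Ideal.mem_bot] at e1 e2
  rcases IsLocalRing.isUnit_or_isUnit_one_sub_self e with h | h
  · have := h.map χ
    rw [e2] at this
    exact not_isUnit_zero this
  · have := h.map ψ
    rw [map_sub, map_one, ← neg_sub, e1, neg_zero] at this
    exact not_isUnit_zero this

theorem comap_mMap {K R G : Type*} [Field K] [CommRing R] [Algebra K R] [Group G]
    (φ : G →* (R ≃ₐ[K] R)) (σ : G) (x : R →ₐ[K] K) (hx : ∀ f, x (φ σ f) = x f) :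
    (RingHom.ker x : Ideal R).comap (thetaMap x).toRingHom =
      (RingHom.ker x : Ideal R).comap (mMap φ σ).toRingHom := by
  have h : x.comp (thetaMap x) = x.comp (mMap φ σ) := by
    apply Algebra.TensorProduct.ext'
    intro u v
    rw [AlgHom.comp_apply, AlgHom.comp_apply, thetaMap_tmul, mMap_tmul, map_mul, map_mul, hx]
    simp
  ext a
  have := DFunLike.congr_fun h a
  change x (thetaMap x a) = 0 ↔ x (mMap φ σ a) = 0
  rw [← AlgHom.comp_apply, ← AlgHom.comp_apply, this]

/-- the local ring at `P` of the scheme-theoretic separating variety -/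
abbrev SRing {K R : Type*} [Field K] [CommRing R] [Algebra K R] (P : Ideal (R ⊗[K] R)) [P.IsPrime]
    (fs : List R) : Type _ :=
  Localization.AtPrime P ⧸ ((⊥ : Ideal (Localization.AtPrime P)) ⊔ Ideal.span {g | g ∈
      (fs.map fun f => algebraMap (R ⊗[K] R) (Localization.AtPrime P)
        ((1 : R) ⊗ₜ[K] f - f ⊗ₜ[K] (1 : R)))})

theorem exists_psi {K R G : Type*} [Field K] [CommRing R] [Algebra K R] [Group G]
    (φ : G →* (R ≃ₐ[K] R)) (σ : G) (fs : List R)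
    (hinv : ∀ f ∈ fs, f ∈ invariantsAlg K R G φ) (m : Ideal R) [m.IsPrime]
    (P : Ideal (R ⊗[K] R)) [P.IsPrime] (hP : P = m.comap (mMap φ σ).toRingHom) :
    ∃ ψ : SRing P fs →+* Localization.AtPrime m, ∀ c : R ⊗[K] R,
      ψ (algebraMap (R ⊗[K] R) (SRing P fs) c) =
        algebraMap R (Localization.AtPrime m) (mMap φ σ c) := by
  let T := Localization.localRingHom P m (mMap φ σ).toRingHom hP
  have hT : ∀ c, T (algebraMap _ _ c) = algebraMap R (Localization.AtPrime m) (mMap φ σ c) :=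
    fun c => Localization.localRingHom_to_map P m (mMap φ σ).toRingHom hP c
  refine ⟨Ideal.Quotient.lift _ T fun d hd => ?_, fun c => ?_⟩
  · rw [← RingHom.mem_ker]
    revert d
    change _ ≤ RingHom.ker T
    rw [bot_sup_eq, Ideal.span_le]
    intro g hg
    obtain ⟨f, hf, rfl⟩ := List.mem_map.1 hg
    rw [SetLike.mem_coe, RingHom.mem_ker, hT, map_sub, mMap_tmul, mMap_tmul, hinv f hf σ]
    simp
  · exact hT c

theorem fixed_mem {K R G : Type*} [Field K] [IsAlgClosed K] [CommRing R]
    [Algebra K R] [Group G] [Finite G] (hfg : Algebra.FiniteType K R)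
    (φ : G →* (R ≃ₐ[K] R))
    (hconn : IsConnected (Set.univ : Set (PrimeSpectrum R)))
    (hCM : cmdefLE R 0)
    (n : ℕ) (hn : ringKrullDim R = (n : WithBot ℕ∞))
    (hsep : gammaSep K R G φ = (n : ℕ∞)) (ρ : G) (hρ : HasFixedPoint K R G φ ρ)
    (H : Subgroup G) (hH : ∀ σ, IsKReflection K R G φ 1 σ → σ ∈ H) : ρ ∈ H := by
  classical
  cases nonempty_fintype G
  by_contra hρH
  have hNR : IsNoetherianRing R := Algebra.FiniteType.isNoetherianRing K R
  have hftA : Algebra.FiniteType K (R ⊗[K] R) := finiteType_tensor K R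
  have hNA : IsNoetherianRing (R ⊗[K] R) := Algebra.FiniteType.isNoetherianRing K _
  obtain ⟨x, hx⟩ := hρ
  obtain ⟨fs, hlen, hinv, hfs⟩ := exists_sep φ n hsep
  let m : Ideal R := RingHom.ker x
  have hmm : m.IsMaximal := ker_maximal x
  have hmp : m.IsPrime := hmm.isPrime
  let P : Ideal (R ⊗[K] R) := m.comap (thetaMap x).toRingHom
  have hPp : P.IsPrime := Ideal.comap_isPrime _ _
  have hht : m.height = fs.length := by
    rw [hlen]; exact equidim hfg hconn hCM n hn m hmm
  have hflat : Module.Flat R (SRing P fs) := flat_S φ fs hfs x m rfl P rfl hCM hht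
  let I : Ideal (R ⊗[K] R) := Ideal.span {g | ∃ f ∈ fs, (1 : R) ⊗ₜ[K] f - f ⊗ₜ[K] (1 : R) = g}
  let T1 : Finset G := Finset.univ.filter fun σ => σ ∈ H
  let T2 : Finset G := Finset.univ.filter fun σ => σ ∉ H
  let I1 := graphIdeal φ T1
  let I2 := graphIdeal φ T2
  have hrad : I1 * I2 ≤ I.radical := by
    refine le_trans ?_ (graphIdeal_le_radical φ fs hfs I fun f hf =>
      Ideal.subset_span ⟨f, hf, rfl⟩)
    refine Ideal.mul_le_inf.trans (Finset.le_inf fun σ _ => ?_)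
    by_cases hσ : σ ∈ H
    · exact inf_le_left.trans (Finset.inf_le (by simp [T1, hσ]))
    · exact inf_le_right.trans (Finset.inf_le (by simp [T2, hσ]))
  obtain ⟨N, hN⟩ := Ideal.exists_pow_le_of_le_radical_of_fg hrad (IsNoetherian.noetherian _)
  let J1 := I1 ^ (N + 1)
  let J2 := I2 ^ (N + 1)
  have hJ : ∀ u ∈ J1, ∀ v ∈ J2, u * v ∈ I := by
    intro u hu v hv
    have h1 := Ideal.mul_mem_mul hu hv
    rw [← mul_pow] at h1
    exact hN (Ideal.pow_le_pow_right (Nat.le_succ N) h1)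
  obtain ⟨a, haj, b, hbj, ha, hb⟩ := exists_reg_pair hCM
    ((J1 ⊔ J2).comap (algebraMap R (R ⊗[K] R))) (by
      intro q hq hle
      obtain ⟨τ, hτ, h⟩ := exists_refl_of_le φ H T1 T2 (by simp [T1]) (by simp [T2]) (N + 1)
        q hq hle
      exact two_le_height φ τ (fun h => hτ (hH τ h)) q hq h)
  obtain ⟨a1, ha1, a2, ha2, hae⟩ := Submodule.mem_sup.1 haj
  obtain ⟨b1, hb1, b2, hb2, hbe⟩ := Submodule.mem_sup.1 hbj
  have hI0 : ∀ c ∈ I, algebraMap (R ⊗[K] R) (SRing P fs) c = 0 := by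
    change I ≤ RingHom.ker (algebraMap (R ⊗[K] R) (SRing P fs))
    rw [Ideal.span_le]
    rintro _ ⟨f, hf, rfl⟩
    rw [SetLike.mem_coe, RingHom.mem_ker]
    change Ideal.Quotient.mk _ (algebraMap (R ⊗[K] R) (Localization.AtPrime P) _) = 0
    rw [Ideal.Quotient.eq_zero_iff_mem]
    exact Ideal.mem_sup_right (Ideal.subset_span (List.mem_map.2 ⟨f, hf, rfl⟩))
  obtain ⟨ψ, hψ⟩ := exists_psi φ 1 fs hinv m P (comap_mMap φ 1 x (by simp))
  obtain ⟨χ, hχ⟩ := exists_psi φ ρ fs hinv m P (comap_mMap φ ρ x hx)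
  have hnt : Nontrivial (SRing P fs) := ψ.domain_nontrivial
  have hloc : IsLocalRing (SRing P fs) :=
    IsLocalRing.of_surjective' (Ideal.Quotient.mk _) Ideal.Quotient.mk_surjective
  have htow : ∀ r, algebraMap R (SRing P fs) r =
      algebraMap (R ⊗[K] R) (SRing P fs) (algebraMap R (R ⊗[K] R) r) := fun r => rfl
  have hmal : ∀ (σ : G) (r : R), mMap φ σ (algebraMap R (R ⊗[K] R) r) = r := by
    intro σ r
    change mMap φ σ (r ⊗ₜ 1) = r
    rw [mMap_tmul]; simp
  have k1 : mMap φ 1 a1 = 0 := by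
    have h1 : a1 ∈ I1 := Ideal.pow_le_self (Nat.succ_ne_zero N) ha1
    exact (Finset.inf_le (by simp [T1, H.one_mem]) : I1 ≤ RingHom.ker (mMap φ 1)) h1
  have k2 : mMap φ ρ a2 = 0 := by
    have h1 : a2 ∈ I2 := Ideal.pow_le_self (Nat.succ_ne_zero N) ha2
    exact (Finset.inf_le (by simp [T2, hρH]) : I2 ≤ RingHom.ker (mMap φ ρ)) h1
  refine final_step (S := SRing P fs) (L := Localization.AtPrime m) a b hb
    (algebraMap _ _ a1) (algebraMap _ _ a2) (algebraMap _ _ b1) (algebraMap _ _ b2)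
    ?_ ?_ ?_ ?_ ψ χ ?_ ?_ ?_ ?_
  · rw [← map_add, hae, htow]
  · rw [← map_add, hbe, htow]
  · rw [← map_mul]; exact hI0 _ (hJ _ ha1 _ hb2)
  · rw [← map_mul]; exact hI0 _ (hJ _ hb1 _ ha2)
  · rw [htow, hψ, hmal]; exact regOn_loc m a ha
  · rw [htow, hχ, hmal]; exact regOn_loc m a ha
  · rw [hψ, k1, map_zero]
  · rw [hχ, k2, map_zero]

section Statements

variable {K R G : Type*} [Field K] [IsAlgClosed K] [CommRing R] [IsReduced R] [Nontrivial R]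
  [Algebra K R] [Group G] [Finite G]

/-- If the n-dimensional affine G-variety X is connected and
Cohen-Macaulay, G is generated by elements having a fixed point, and γ_sep = n, then G
is generated by reflections. -/
theorem generated_by_reflections_of_gammaSep_eq_dim (hfg : Algebra.FiniteType K R)
    (φ : G →* (R ≃ₐ[K] R))
    (hconn : IsConnected (Set.univ : Set (PrimeSpectrum R)))
    (hCM : cmdefLE R 0)
    (hgen : Subgroup.closure {σ : G | HasFixedPoint K R G φ σ} = ⊤)
    (n : ℕ) (hn : ringKrullDim R = (n : WithBot ℕ∞))
    (hsep : gammaSep K R G φ = (n : ℕ∞)) :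
    Subgroup.closure {σ : G | IsKReflection K R G φ 1 σ} = ⊤ := by
  rw [eq_top_iff, ← hgen, Subgroup.closure_le]
  intro ρ hρ
  exact fixed_mem hfg φ hconn hCM n hn hsep ρ hρ _ fun σ hσ => Subgroup.subset_closure hσ

end Statements
end Defs
end
end

section
/- Let X be an irreducible affine G-variety and A ⊆ K[X]^G a finitely generated separating subalgebra such that K[X]^G is a finite A-module. Then the induced morphism θ: Spec(K[X]^G) → Spec(A) is a universal homeomorphism (finite, surjective, and universally injective). -/
noncomputable section

open TensorProduct PrimeSpectrum

section Defs

variable (K R G : Type*) [Field K] [CommRing R] [Algebra K R] [Group G]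

section Statements

attribute [local instance] Algebra.TensorProduct.rightAlgebra

set_option synthInstance.maxHeartbeats 1000000
set_option maxHeartbeats 1000000

universe u

theorem sauh_ext {B S L : Type*} [CommRing B] [CommRing S] [Field L] [IsAlgClosed L]
    (f : B →+* S) (hf : f.IsIntegral) (hinj : Function.Injective f) (x : B →+* L) :
    ∃ y : S →+* L, y.comp f = x := by
  obtain ⟨Q, hQ⟩ := hf.comap_surjective hinj ⟨RingHom.ker x, RingHom.ker_isPrime x⟩
  have hQ' : Q.asIdeal.comap f = RingHom.ker x := congrArg PrimeSpectrum.asIdeal hQ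
  let g : B ⧸ RingHom.ker x →+* S ⧸ Q.asIdeal := Ideal.quotientMap Q.asIdeal f hQ'.ge
  have hg : Function.Injective g := Ideal.quotientMap_injective' hQ'.le
  have hgi : g.IsIntegral := by
    have h1 : (g.comp (Ideal.Quotient.mk (RingHom.ker x))).IsIntegral := by
      have : g.comp (Ideal.Quotient.mk (RingHom.ker x)) = (Ideal.Quotient.mk Q.asIdeal).comp f := by
        ext b; simp [g]
      rw [this]
      exact hf.trans _ _ (RingHom.isIntegral_of_surjective _ Ideal.Quotient.mk_surjective)
    exact RingHom.IsIntegral.tower_top _ _ h1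
  let k : B ⧸ RingHom.ker x →+* L := RingHom.kerLift x
  have hk : Function.Injective k := RingHom.kerLift_injective x
  have : (RingHom.ker x).IsPrime := RingHom.ker_isPrime x
  have : IsDomain (B ⧸ RingHom.ker x) := Ideal.Quotient.isDomain _
  have : IsDomain (S ⧸ Q.asIdeal) := Ideal.Quotient.isDomain _
  let := g.toAlgebra
  let := k.toAlgebra
  have : Module.IsTorsionFree (B ⧸ RingHom.ker x) (S ⧸ Q.asIdeal) :=
    (Module.isTorsionFree_iff_algebraMap_injective).2 hg
  have : Module.IsTorsionFree (B ⧸ RingHom.ker x) L :=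
    (Module.isTorsionFree_iff_algebraMap_injective).2 hk
  have : Algebra.IsIntegral (B ⧸ RingHom.ker x) (S ⧸ Q.asIdeal) := ⟨hgi⟩
  let l : (S ⧸ Q.asIdeal) →ₐ[B ⧸ RingHom.ker x] L := IsAlgClosed.lift
  refine ⟨l.toRingHom.comp (Ideal.Quotient.mk _), ?_⟩
  ext b
  have := l.commutes (Ideal.Quotient.mk _ b)
  simpa [RingHom.algebraMap_toAlgebra, g, k] using this

theorem sauh_homeo {A B : Type u} [CommRing A] [CommRing B] [Algebra A B]
    (hint : Algebra.IsIntegral A B) (hinj : Function.Injective (algebraMap A B))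
    (H : ∀ (L : Type u) [Field L] (x y : B →+* L),
      x.comp (algebraMap A B) = y.comp (algebraMap A B) → x = y)
    (C : Type u) [CommRing C] [Algebra A C] :
    IsHomeomorph (PrimeSpectrum.comap (algebraMap C (B ⊗[A] C))) := by
  have hintD : (algebraMap C (B ⊗[A] C)).IsIntegral := by
    have h := (algebraMap_isIntegral_iff (R := C) (A := C ⊗[A] B)).2 inferInstance
    have e : algebraMap C (B ⊗[A] C) = ((Algebra.TensorProduct.comm A C B : _ ≃ₐ[A] _) :
        C ⊗[A] B →+* B ⊗[A] C).comp (algebraMap C (C ⊗[A] B)) := by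
      ext c; simp [Algebra.TensorProduct.right_algebraMap_apply]
    rw [e]
    exact h.trans _ _ (RingHom.isIntegral_of_surjective _
      (Algebra.TensorProduct.comm A C B).surjective)
  rw [isHomeomorph_iff_continuous_isClosedMap_bijective]
  refine ⟨PrimeSpectrum.continuous_comap _, PrimeSpectrum.isClosedMap_comap_of_isIntegral _ hintD,
    ?_, ?_⟩
  · intro P Q hPQ
    let c := algebraMap C (B ⊗[A] C)
    let p := P.asIdeal.comap c
    have hp : p = Q.asIdeal.comap c := congrArg PrimeSpectrum.asIdeal hPQ
    let Ω := AlgebraicClosure (FractionRing (C ⧸ p))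
    let w : C ⧸ p →+* Ω := (algebraMap (FractionRing (C ⧸ p)) Ω).comp (algebraMap _ _)
    have hw : Function.Injective w :=
      (algebraMap (FractionRing (C ⧸ p)) Ω).injective.comp (IsFractionRing.injective _ _)
    have key : ∀ Q : PrimeSpectrum (B ⊗[A] C), p = Q.asIdeal.comap c →
        ∃ z : B ⊗[A] C →+* Ω, z.comp c = w.comp (Ideal.Quotient.mk p) ∧
          RingHom.ker z = Q.asIdeal := by
      intro Q hQ
      let g : C ⧸ p →+* (B ⊗[A] C) ⧸ Q.asIdeal := Ideal.quotientMap Q.asIdeal c hQ.le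
      have hg : Function.Injective g := Ideal.quotientMap_injective' hQ.ge
      have e : g.comp (Ideal.Quotient.mk p) = (Ideal.Quotient.mk Q.asIdeal).comp c := by
        ext b; simp [g]
      have hgi : g.IsIntegral := by
        have h1 : (g.comp (Ideal.Quotient.mk p)).IsIntegral := by
          rw [e]
          exact RingHom.IsIntegral.trans _ _ hintD
            (RingHom.isIntegral_of_surjective _ Ideal.Quotient.mk_surjective)
        exact RingHom.IsIntegral.tower_top _ _ h1
      obtain ⟨z, hz⟩ := sauh_ext g hgi hg w
      refine ⟨z.comp (Ideal.Quotient.mk _), ?_, ?_⟩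
      · rw [RingHom.comp_assoc, ← e, ← RingHom.comp_assoc, hz]
      · have hzi : RingHom.ker z = ⊥ := by
          let := g.toAlgebra
          have : Algebra.IsIntegral (C ⧸ p) ((B ⊗[A] C) ⧸ Q.asIdeal) := ⟨hgi⟩
          apply Ideal.eq_bot_of_comap_eq_bot (R := C ⧸ p)
          change (RingHom.ker z).comap g = ⊥
          rw [RingHom.comap_ker, hz]
          exact (RingHom.injective_iff_ker_eq_bot _).1 hw
        rw [← RingHom.comap_ker, hzi, ← RingHom.ker_eq_comap_bot, Ideal.mk_ker]
    obtain ⟨x, hx, hxk⟩ := key P rfl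
    obtain ⟨y, hy, hyk⟩ := key Q hp
    have hxy : x = y := by
      have h2 : x.comp c = y.comp c := hx.trans hy.symm
      have hl : x.comp Algebra.TensorProduct.includeLeftRingHom =
          y.comp Algebra.TensorProduct.includeLeftRingHom := by
        apply H
        ext a
        have := congrArg (fun f : C →+* Ω => f (algebraMap A C a)) h2
        have e0 : (algebraMap A B a) ⊗ₜ[A] (1 : C) = (1 : B) ⊗ₜ[A] (algebraMap A C a) := by
          rw [Algebra.algebraMap_eq_smul_one, Algebra.algebraMap_eq_smul_one,
            TensorProduct.smul_tmul]
        change x (algebraMap A B a ⊗ₜ[A] (1 : C)) = y (algebraMap A B a ⊗ₜ[A] (1 : C))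
        rw [e0]
        exact this
      refine RingHom.ext fun t => ?_
      induction t using TensorProduct.induction_on with
      | zero => simp
      | add a b ha hb => rw [map_add, map_add, ha, hb]
      | tmul b d =>
        have e1 : x (b ⊗ₜ 1) = y (b ⊗ₜ 1) := congrArg (fun f : B →+* Ω => f b) hl
        have e2 : x (1 ⊗ₜ d) = y (1 ⊗ₜ d) := congrArg (fun f : C →+* Ω => f d) h2
        have : b ⊗ₜ[A] d = (b ⊗ₜ 1) * (1 ⊗ₜ d) := by simp
        rw [this, map_mul, map_mul, e1, e2]
    ext1
    rw [← hxk, ← hyk, hxy]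
  · intro p
    let Ω := AlgebraicClosure (FractionRing (C ⧸ p.asIdeal))
    let w : C →+* Ω := ((algebraMap (FractionRing (C ⧸ p.asIdeal)) Ω).comp (algebraMap _ _)).comp
      (Ideal.Quotient.mk p.asIdeal)
    have hw : RingHom.ker w = p.asIdeal := by
      have : Function.Injective
          ((algebraMap (FractionRing (C ⧸ p.asIdeal)) Ω).comp (algebraMap (C ⧸ p.asIdeal) _)) :=
        (algebraMap (FractionRing (C ⧸ p.asIdeal)) Ω).injective.comp (IsFractionRing.injective _ _)
      rw [← RingHom.comap_ker, (RingHom.injective_iff_ker_eq_bot _).1 this,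
        ← RingHom.ker_eq_comap_bot, Ideal.mk_ker]
    obtain ⟨v, hv⟩ := sauh_ext (algebraMap A B) hint.1 hinj (w.comp (algebraMap A C))
    let : Algebra A Ω := (w.comp (algebraMap A C)).toAlgebra
    let v' : B →ₐ[A] Ω := ⟨v, fun a => congrArg (fun f : A →+* Ω => f a) hv⟩
    let w' : C →ₐ[A] Ω := ⟨w, fun a => rfl⟩
    let z : B ⊗[A] C →ₐ[A] Ω := Algebra.TensorProduct.productMap v' w'
    refine ⟨⟨RingHom.ker (z : B ⊗[A] C →+* Ω), RingHom.ker_isPrime _⟩, ?_⟩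
    ext1
    change (RingHom.ker (z : B ⊗[A] C →+* Ω)).comap (algebraMap C (B ⊗[A] C)) = _
    rw [RingHom.comap_ker]
    refine Eq.trans ?_ hw
    congr 1
    ext c
    simp [z, w', Algebra.TensorProduct.right_algebraMap_apply]

theorem sauh_nilp {K A B : Type u} [Field K] [IsAlgClosed K] [CommRing A] [CommRing B]
    [Algebra K A] [Algebra K B] [Algebra A B] [IsScalarTower K A B]
    [Algebra.FiniteType K A] [Module.Finite A B]
    (hs : ∀ x y : B →ₐ[K] K, (∀ a : A, x (algebraMap A B a) = y (algebraMap A B a)) → x = y)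
    (L : Type u) [Field L] (x y : B →+* L)
    (hxy : x.comp (algebraMap A B) = y.comp (algebraMap A B)) : x = y := by
  have : Algebra.FiniteType K (B ⊗[A] B) := Algebra.FiniteType.trans (S := A) ‹_› inferInstance
  have : IsJacobsonRing (B ⊗[A] B) := isJacobsonRing_of_finiteType (A := K)
  have hn : ∀ f : B, IsNilpotent (f ⊗ₜ[A] (1 : B) - (1 : B) ⊗ₜ[A] f) := by
    intro f
    rw [← mem_nilradical, nilradical,
      ← IsJacobsonRing.out ‹_› (Ideal.radical_isRadical (0 : Ideal (B ⊗[A] B))), Ideal.jacobson,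
      Ideal.mem_sInf]
    rintro M ⟨-, hM⟩
    let := Ideal.Quotient.field M
    have : Module.Finite K ((B ⊗[A] B) ⧸ M) := finite_of_finite_type_of_isJacobsonRing K _
    have hb := IsAlgClosed.algebraMap_bijective_of_isIntegral (k := K) (K := (B ⊗[A] B) ⧸ M)
    let e : K ≃ₐ[K] ((B ⊗[A] B) ⧸ M) := AlgEquiv.ofBijective (Algebra.ofId _ _) hb
    let q : (B ⊗[A] B) →ₐ[K] K := (e.symm : _ →ₐ[K] K).comp (Ideal.Quotient.mkₐ K M)
    let i1 : B →ₐ[K] B ⊗[A] B :=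
      (Algebra.TensorProduct.includeLeft : B →ₐ[A] B ⊗[A] B).restrictScalars K
    let i2 : B →ₐ[K] B ⊗[A] B :=
      (Algebra.TensorProduct.includeRight : B →ₐ[A] B ⊗[A] B).restrictScalars K
    have h12 := hs (q.comp i1) (q.comp i2) (by
      intro a
      have : i1 (algebraMap A B a) = i2 (algebraMap A B a) := by
        simp [i1, i2, Algebra.algebraMap_eq_smul_one, TensorProduct.smul_tmul]
      simp only [AlgHom.comp_apply, this])
    have hf : q (i1 f) = q (i2 f) := congrArg (fun g : B →ₐ[K] K => g f) h12
    have hf' : Ideal.Quotient.mk M (i1 f) = Ideal.Quotient.mk M (i2 f) := e.symm.injective hf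
    exact Ideal.Quotient.eq.1 hf'
  ext f
  let : Algebra A L := (x.comp (algebraMap A B)).toAlgebra
  let x' : B →ₐ[A] L := ⟨x, fun a => rfl⟩
  let y' : B →ₐ[A] L := ⟨y, fun a => (congrArg (fun f : A →+* L => f a) hxy).symm⟩
  have h := ((hn f).map (Algebra.TensorProduct.productMap x' y')).eq_zero
  simp only [map_sub, Algebra.TensorProduct.productMap_apply_tmul, map_one, mul_one, one_mul] at h
  exact sub_eq_zero.1 h

variable {K : Type u} {R : Type u} {G : Type u} [Field K] [IsAlgClosed K] [CommRing R]
  [IsDomain R] [Algebra K R] [Group G] [Finite G]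

/-- Let X be an irreducible affine G-variety and A ⊆ K[X]^G a finitely
generated separating subalgebra such that K[X]^G is a finite A-module.  Then the induced
morphism θ : Spec(K[X]^G) → Spec(A) is a universal homeomorphism: every base change
Spec(K[X]^G ⊗_A C) → Spec(C) is a homeomorphism. -/
theorem separating_algebra_universal_homeomorphism (hfg : Algebra.FiniteType K R)
    (φ : G →* (R ≃ₐ[K] R))
    (A : Subalgebra K (invariantsAlg K R G φ)) (hAfg : A.FG)
    (hsep : ∀ x y : R →ₐ[K] K,
      (∃ f ∈ invariantsAlg K R G φ, x f ≠ y f) →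
        ∃ g : invariantsAlg K R G φ, g ∈ A ∧ x (g : R) ≠ y (g : R))
    (hfin : Module.Finite A (invariantsAlg K R G φ)) :
    ∀ (C : Type u) [CommRing C] [Algebra A C],
      IsHomeomorph (PrimeSpectrum.comap
        (algebraMap C ((invariantsAlg K R G φ) ⊗[A] C))) := by
  intro C _ _
  have hR : Algebra.IsIntegral (invariantsAlg K R G φ) R := by
    let : MulSemiringAction G R := MulSemiringAction.compHom R
      ((MulSemiringAction.toRingAut (R ≃ₐ[K] R) R).comp φ)
    have : Algebra.IsInvariant (invariantsAlg K R G φ) R G :=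
      ⟨fun b hb => ⟨⟨b, hb⟩, rfl⟩⟩
    exact Algebra.IsInvariant.isIntegral _ R G
  have hext : ∀ x : invariantsAlg K R G φ →ₐ[K] K, ∃ y : R →ₐ[K] K,
      ∀ f : invariantsAlg K R G φ, y (f : R) = x f := by
    intro x
    obtain ⟨y, hy⟩ := sauh_ext (algebraMap (invariantsAlg K R G φ) R) hR.1
      Subtype.val_injective (x : invariantsAlg K R G φ →+* K)
    have hy' : ∀ f : invariantsAlg K R G φ, y (f : R) = x f := fun f =>
      congrArg (fun g : invariantsAlg K R G φ →+* K => g f) hy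
    refine ⟨⟨y, fun k => ?_⟩, hy'⟩
    exact (hy' (algebraMap K _ k)).trans (x.commutes k)
  have : Algebra.FiniteType K A := (Subalgebra.fg_iff_finiteType A).1 hAfg
  refine sauh_homeo inferInstance Subtype.val_injective (fun L _ x y hxy => ?_) C
  refine sauh_nilp (K := K) (A := A) ?_ L x y hxy
  intro x y hxy
  obtain ⟨x', hx'⟩ := hext x
  obtain ⟨y', hy'⟩ := hext y
  ext f
  by_contra hne
  obtain ⟨g, hgA, hg⟩ := hsep x' y' ⟨f, f.2, by rw [hx', hy']; exact hne⟩
  rw [hx', hy'] at hg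
  exact hg (hxy ⟨g, hgA⟩)

end Statements
end Defs
end
end
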